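/- Fix an even integer c ≥ 2 and let ν_c be the pairwise-uniform distribution on {±1}^{c²×4} defined from X_{+2} and X_{−2}. Form a random distributional CSP with n Boolean variables (n even) and m = Δn constraints of arity 4c², each constraint choosing a uniformly random scope of 4c² distinct variables and carrying the distribution ν_c; additionally impose the global constraint that the assignment is exactly balanced, Σ_{i=1}^n x_i = 0. Then with probability 1 − o(1), there exists a pseudoexpectation of degree Ω(n/(Δ²·log Δ)) that satisfies the identity Σ_{i=1}^n x_i = 0 with pseudovariance zero and whose local marginal on each constraint's scope equals ν_c (i.e., for each constraint scope S of arity 4c² and each a ∈ {±1}^{4c²}, pE of the multilinear arithmetization of the indicator 1_{x_S=a} equals ν_c(a)). -/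

import Mathlib

open MvPolynomial Finset

/-- Probability of an event under the uniform distribution on a finite sample space. -/
noncomputable def uprob {Ω : Type} [Fintype Ω] (p : Ω → Prop) : ℝ :=
  letI := Classical.decPred p
  ((Finset.univ.filter p).card : ℝ) / (Fintype.card Ω : ℝ)

/-- A distribution `μ` on `ι → Bool` is `j`-wise uniform: its marginal on every set of at most
`j` coordinates is uniform. -/
def kwiseUniform {ι : Type} [Fintype ι] [DecidableEq ι] (j : ℕ) (μ : (ι → Bool) → ℝ) : Prop :=
  ∀ A : Finset ι, A.card ≤ j → ∀ a : ι → Bool,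
    ∑ x ∈ Finset.univ.filter (fun x : ι → Bool => ∀ i ∈ A, x i = a i), μ x
      = (1 / 2 : ℝ) ^ A.card

/-- `μ` is a probability distribution on the finite type `α`. -/
def IsDist {α : Type} [Fintype α] (μ : α → ℝ) : Prop :=
  (∀ x, 0 ≤ μ x) ∧ ∑ x, μ x = 1

/-- The ±1 sign encoded by a Boolean (`true ↦ +1`). -/
noncomputable def sgn (b : Bool) : ℝ := if b then 1 else -1

/-- A degree-`d` pseudoexpectation over `{±1}`-valued variables `x_1, …, x_n`. -/
structure PEpm (n d : ℕ) where
  pE : MvPolynomial (Fin n) ℝ →ₗ[ℝ] ℝ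
  normalized : pE 1 = 1
  multilin : ∀ p q : MvPolynomial (Fin n) ℝ,
    (∀ x : Fin n → Bool,
        MvPolynomial.eval (fun i => sgn (x i)) p = MvPolynomial.eval (fun i => sgn (x i)) q) →
      pE p = pE q
  psd : ∀ p : MvPolynomial (Fin n) ℝ, 2 * p.totalDegree ≤ d → 0 ≤ pE (p ^ 2)

/-- The pseudoexpectation satisfies the identity `Q = b` with pseudovariance zero. -/
def PEpm.satEq {n d : ℕ} (E : PEpm n d) (Q : MvPolynomial (Fin n) ℝ) (b : ℝ) : Prop :=
  E.pE Q = b ∧ E.pE (Q ^ 2) = b ^ 2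

/-- The multilinear arithmetization (in ±1 variables) of the 0/1-indicator of `x_S = a`. -/
noncomputable def indPM {n : ℕ} {ι : Type} [Fintype ι] (S : ι → Fin n) (a : ι → Bool) :
    MvPolynomial (Fin n) ℝ :=
  ∏ i, (MvPolynomial.C (1 / 2 : ℝ) * (1 + MvPolynomial.C (sgn (a i)) * MvPolynomial.X (S i)))

/-- The arithmetization of the 0/1-indicator of the constraint "`P`, applied to the ±1 variables
of the scope `S` with signs flipped according to `z`, equals 1". -/
noncomputable def consPolyPM {n k : ℕ} (P : (Fin k → Bool) → Bool)
    (S : Fin k → Fin n) (z : Fin k → Bool) : MvPolynomial (Fin n) ℝ :=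
  ∑ a ∈ Finset.univ.filter
      (fun a : Fin k → Bool => P (fun i => Bool.xor (a i) (z i)) = true),
    indPM S a

/-- The ±1 sum of a row of the matrix `M`. -/
def rowSum {c : ℕ} (M : Fin (c ^ 2) × Fin 4 → Bool) (l : Fin (c ^ 2)) : ℤ :=
  ∑ i : Fin 4, (if M (l, i) then (1 : ℤ) else -1)

/-- The distribution ν_c on c²×4 ±1 matrices (probability mass function): with probability 1/2,
a uniformly random set of h+c rows (h = c(c-1)/2) is filled with independent uniform strings of
sum +2 and the remaining h rows with independent uniform strings of sum -2; with probability
1/2, the roles of +2 and -2 are swapped. -/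
noncomputable def nuC (c : ℕ) (M : Fin (c ^ 2) × Fin 4 → Bool) : ℝ :=
  if ∀ l, rowSum M l = 2 ∨ rowSum M l = -2 then
    (if (Finset.univ.filter fun l => rowSum M l = 2).card = c * (c - 1) / 2 + c then
      (1 / 2 : ℝ) * (1 / (((c ^ 2).choose (c * (c - 1) / 2 + c) : ℕ) : ℝ))
        * (1 / 4 : ℝ) ^ (c ^ 2) else 0)
    + (if (Finset.univ.filter fun l => rowSum M l = -2).card = c * (c - 1) / 2 + c then
      (1 / 2 : ℝ) * (1 / (((c ^ 2).choose (c * (c - 1) / 2 + c) : ℕ) : ℝ))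
        * (1 / 4 : ℝ) ^ (c ^ 2) else 0)
  else 0

section Predimension

variable {V J : Type*} [DecidableEq V]

/-- The variables of the scopes of `C` outside `W` are controlled by those of subsets `T j` of the
scopes. -/
theorem card_biUnion_scopes_sdiff_le {S T : J → Finset V} {k : ℕ} (hS : ∀ j, (S j).card = k)
    (C : Finset J) (hT : ∀ j ∈ C, T j ⊆ S j) (W : Finset V) :
    (C.biUnion S \ W).card + ∑ j ∈ C, (T j).card ≤ k * C.card + (C.biUnion T \ W).card := by
  have h1 : C.biUnion S \ W ⊆ (C.biUnion fun j => S j \ T j) ∪ (C.biUnion T \ W) := by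
    intro v hv
    simp only [Finset.mem_sdiff, Finset.mem_biUnion, Finset.mem_union] at hv ⊢
    obtain ⟨⟨j, hj, hvj⟩, hvW⟩ := hv
    by_cases h : v ∈ T j
    · exact Or.inr ⟨⟨j, hj, h⟩, hvW⟩
    · exact Or.inl ⟨j, hj, hvj, h⟩
  have h2 := (Finset.card_le_card h1).trans (Finset.card_union_le _ _)
  have h3 : (C.biUnion fun j => S j \ T j).card ≤ ∑ j ∈ C, (S j \ T j).card :=
    Finset.card_biUnion_le
  have h4 : ∑ j ∈ C, (S j \ T j).card + ∑ j ∈ C, (T j).card = k * C.card := by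
    rw [← Finset.sum_add_distrib, Finset.sum_congr rfl fun j hj => by
      rw [Finset.card_sdiff_add_card_eq_card (hT j hj), hS j]]
    simp [mul_comm]
  omega

theorem sum_card_eq_sum_degree [Fintype V] (C : Finset J) (T : J → Finset V) :
    ∑ j ∈ C, (T j).card = ∑ v, (C.filter fun j => v ∈ T j).card := by
  have := Finset.sum_card_bipartiteAbove_eq_sum_card_bipartiteBelow
    (s := C) (t := (Finset.univ : Finset V)) (fun j v => v ∈ T j)
  simpa [Finset.bipartiteAbove, Finset.bipartiteBelow] using this

theorem mem_biUnion_iff_degree_pos (C : Finset J) (T : J → Finset V) (v : V) :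
    v ∈ C.biUnion T ↔ 0 < (C.filter fun j => v ∈ T j).card := by
  simp [Finset.card_pos, Finset.Nonempty, Finset.mem_biUnion]

theorem card_eq_sum_ite [Fintype V] (U : Finset V) : U.card = ∑ v, if v ∈ U then 1 else 0 := by
  simp

variable [DecidableEq J]

/-- Twice the predimension `|W| - (k - 3/2) |C|` of a set `W` of variables together with a set `C`
of constraints of arity `k`. -/
def predim (k : ℕ) (P : Finset V × Finset J) : ℤ :=
  2 * (P.1.card : ℤ) - (2 * (k : ℤ) - 3) * (P.2.card : ℤ)

/-- The scopes of all the constraints of `P` lie among the variables of `P`. -/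
def ContainsScopes (S : J → Finset V) (P : Finset V × Finset J) : Prop :=
  ∀ j ∈ P.2, S j ⊆ P.1

/-- `P` is self-sufficient: adding variables, or up to `r` constraints, strictly increases the
predimension. -/
def SelfSufficient (S : J → Finset V) (k r : ℕ) (P : Finset V × Finset J) : Prop :=
  ContainsScopes S P ∧ ∀ X, ContainsScopes S X → P < X → (X.2 \ P.2).card ≤ r →
    predim k P < predim k X

theorem predim_sup_add_inf (k : ℕ) (P Q : Finset V × Finset J) :
    predim k (P ⊔ Q) + predim k (P ⊓ Q) = predim k P + predim k Q := by
  have h1 := Finset.card_union_add_card_inter P.1 Q.1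
  have h2 := Finset.card_union_add_card_inter P.2 Q.2
  simp only [predim, Prod.fst_sup, Prod.snd_sup, Prod.fst_inf, Prod.snd_inf, Finset.sup_eq_union,
    Finset.inf_eq_inter]
  zify at h1 h2
  linear_combination 2 * h1 - (2 * (k : ℤ) - 3) * h2

theorem ContainsScopes.sup {S : J → Finset V} {P Q : Finset V × Finset J}
    (hP : ContainsScopes S P) (hQ : ContainsScopes S Q) : ContainsScopes S (P ⊔ Q) := by
  intro j hj
  rcases Finset.mem_union.1 hj with h | h
  · exact (hP j h).trans Finset.subset_union_left
  · exact (hQ j h).trans Finset.subset_union_right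

theorem ContainsScopes.inf {S : J → Finset V} {P Q : Finset V × Finset J}
    (hP : ContainsScopes S P) (hQ : ContainsScopes S Q) : ContainsScopes S (P ⊓ Q) := by
  intro j hj
  have h := Finset.mem_inter.1 hj
  exact Finset.subset_inter (hP j h.1) (hQ j h.2)

theorem SelfSufficient.predim_inf_le {S : J → Finset V} {k r : ℕ} {A X : Finset V × Finset J}
    (hA : SelfSufficient S k r A) (hX : ContainsScopes S X) (hr : (X.2 \ A.2).card ≤ r) :
    predim k (X ⊓ A) ≤ predim k X ∧ (¬ X ≤ A → predim k (X ⊓ A) < predim k X) := by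
  have hmod := predim_sup_add_inf k X A
  have key : ¬ X ≤ A → predim k (X ⊓ A) < predim k X := by
    intro hXA
    have := hA.2 (X ⊔ A) (hX.sup hA.1) (lt_of_le_of_ne le_sup_right fun h => hXA (by
      rw [h]; exact le_sup_left)) (by
        rw [Prod.snd_sup, Finset.sup_eq_union, Finset.union_sdiff_right]; exact hr)
    omega
  refine ⟨?_, key⟩
  by_cases h : X ≤ A
  · rw [inf_eq_left.2 h]
  · exact (key h).le

theorem SelfSufficient.inf {S : J → Finset V} {k r : ℕ} {A B : Finset V × Finset J}
    (hA : SelfSufficient S k r A) (hB : SelfSufficient S k r B) :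
    SelfSufficient S k r (A ⊓ B) := by
  refine ⟨hA.1.inf hB.1, fun X hX hlt hr => ?_⟩
  have h1 := hA.predim_inf_le hX ((Finset.card_le_card
    (Finset.sdiff_subset_sdiff subset_rfl Finset.inter_subset_left)).trans hr)
  have h2 := hB.predim_inf_le (hX.inf hA.1) ((Finset.card_le_card (by
    intro j hj
    simp only [Prod.snd_inf, Finset.inf_eq_inter, Finset.mem_sdiff, Finset.mem_inter] at hj ⊢
    tauto)).trans hr)
  have h3 : X ⊓ A ⊓ B = A ⊓ B := by
    rw [inf_assoc]; exact inf_eq_right.2 hlt.le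
  rw [h3] at h2
  by_cases h : X ≤ A
  · have h' : X ⊓ A = X := inf_eq_left.2 h
    rw [h'] at h2
    exact h2.2 fun hB' => hlt.not_ge (le_inf h hB')
  · exact h2.1.trans_lt (h1.2 h)

/-- Every set of at most `d` variables lies in a self-sufficient set with few constraints. -/
theorem exists_selfSufficient [Fintype V] [Fintype J] {S : J → Finset V} {k r s₀ d : ℕ}
    (hexp : ∀ C : Finset J, C.card ≤ s₀ + r →
      2 * ((C.biUnion S).card : ℤ) - (2 * (k : ℤ) - 3) * C.card ≤ 2 * d → C.card ≤ s₀)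
    (W : Finset V) (hW : W.card ≤ d) :
    ∃ A, SelfSufficient S k r A ∧ A.2.card ≤ s₀ ∧ W ⊆ A.1 := by
  classical
  set F : Finset (Finset V × Finset J) := Finset.univ.filter fun A =>
    ContainsScopes S A ∧ W ⊆ A.1 ∧ A.2.card ≤ s₀ + r with hF
  have hne : (W, (∅ : Finset J)) ∈ F := by
    rw [hF, Finset.mem_filter]
    exact ⟨Finset.mem_univ _, by simp [ContainsScopes], subset_rfl, by simp⟩
  obtain ⟨A₀, hA₀, hmin⟩ := F.exists_min_image (predim k) ⟨_, hne⟩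
  obtain ⟨A, hA, hmax⟩ := (F.filter fun A => predim k A = predim k A₀).exists_max_image
    (fun A => A.1.card + A.2.card) ⟨A₀, by simp [hA₀]⟩
  simp only [Finset.mem_filter] at hA hmax
  have hAF := hA.1
  simp only [hF, Finset.mem_filter, Finset.mem_univ, true_and] at hAF
  have hcard : A.2.card ≤ s₀ := by
    refine hexp A.2 hAF.2.2 ?_
    have h1 := hmin _ hne
    rw [← hA.2] at h1
    have h2 : (A.2.biUnion S).card ≤ A.1.card :=
      Finset.card_le_card (Finset.biUnion_subset.2 hAF.1)
    simp only [predim, Finset.card_empty] at h1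
    push_cast at h1
    linarith [(Nat.cast_le (α := ℤ)).2 h2, (Nat.cast_le (α := ℤ)).2 hW]
  refine ⟨A, ⟨hAF.1, fun X hX hlt hr => ?_⟩, hcard, hAF.2.1⟩
  have hXF : X ∈ F := by
    simp only [hF, Finset.mem_filter, Finset.mem_univ, true_and]
    refine ⟨hX, hAF.2.1.trans hlt.le.1, ?_⟩
    have := Finset.card_le_card_sdiff_add_card (s := X.2) (t := A.2)
    omega
  refine lt_of_le_of_ne (hA.2 ▸ hmin X hXF) fun heq => ?_
  have h1 := hmax X ⟨hXF, by rw [← heq, hA.2]⟩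
  have h2 := Finset.card_le_card hlt.le.1
  have h3 := Finset.card_le_card hlt.le.2
  refine hlt.ne (Prod.ext (Finset.eq_of_subset_of_card_le hlt.le.1 (by omega))
    (Finset.eq_of_subset_of_card_le hlt.le.2 (by omega)))

/-- No constraints outside two self-sufficient sets can link them together. -/
theorem SelfSufficient.exists_odd_degree [Fintype V] {S : J → Finset V} {k r : ℕ}
    (hS : ∀ j, (S j).card = k)
    {A B : Finset V × Finset J} (hA : SelfSufficient S k r A) (hB : SelfSufficient S k r B)
    {C : Finset J} (hC : C.Nonempty) (hCA : Disjoint C A.2) (hCB : Disjoint C B.2)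
    (hr : C.card ≤ r) {T : J → Finset V} (hT : ∀ j ∈ C, T j ⊆ S j)
    (hT3 : ∀ j ∈ C, 3 ≤ (T j).card) :
    ∃ v ∉ A.1 ∪ B.1, Odd (C.filter fun j => v ∈ T j).card := by
  by_contra! hodd
  have hext : ∀ P : Finset V × Finset J, SelfSufficient S k r P → Disjoint C P.2 →
      (2 * (k : ℤ) - 3) * C.card < 2 * (C.biUnion S \ P.1).card := by
    intro P hP hCP
    have h := hP.2 (P.1 ∪ C.biUnion S, P.2 ∪ C) (by
      intro j hj
      rcases Finset.mem_union.1 hj with h | h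
      · exact (hP.1 j h).trans Finset.subset_union_left
      · exact (Finset.subset_biUnion_of_mem S h).trans Finset.subset_union_right)
      (lt_of_le_of_ne ⟨Finset.subset_union_left, Finset.subset_union_left⟩ (by
        intro h
        obtain ⟨j, hj⟩ := hC
        have h2 : P.2 = P.2 ∪ C := congrArg Prod.snd h
        exact (Finset.disjoint_left.1 hCP hj) (h2 ▸ Finset.mem_union_right _ hj)))
      ((Finset.card_le_card (by
        intro j hj
        simp only [Finset.mem_sdiff, Finset.mem_union] at hj
        tauto)).trans hr)
    have e1 : (P.1 ∪ C.biUnion S).card = P.1.card + (C.biUnion S \ P.1).card := by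
      rw [← Finset.union_sdiff_self_eq_union, Finset.card_union_of_disjoint Finset.disjoint_sdiff]
    have e2 : (P.2 ∪ C).card = P.2.card + C.card :=
      Finset.card_union_of_disjoint hCP.symm
    simp only [predim, e1, e2] at h
    push_cast at h
    linarith
  have hA' := hext A hA hCA
  have hB' := hext B hB hCB
  have cA := card_biUnion_scopes_sdiff_le hS C hT A.1
  have cB := card_biUnion_scopes_sdiff_le hS C hT B.1
  have hsum : (C.biUnion T \ A.1).card + (C.biUnion T \ B.1).card ≤ ∑ j ∈ C, (T j).card := by
    rw [sum_card_eq_sum_degree, card_eq_sum_ite (C.biUnion T \ A.1),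
      card_eq_sum_ite (C.biUnion T \ B.1), ← Finset.sum_add_distrib]
    refine Finset.sum_le_sum fun v _ => ?_
    have hv := hodd v
    simp only [Finset.mem_sdiff, mem_biUnion_iff_degree_pos, Finset.mem_union, not_or,
      Nat.not_odd_iff_even] at hv ⊢
    by_cases h1 : v ∈ A.1 <;> by_cases h2 : v ∈ B.1 <;> simp only [h1, h2] at hv ⊢
    · simp
    · simp only [not_true_eq_false, not_false_eq_true, and_true, and_false, if_false]
      split_ifs <;> omega
    · simp only [not_true_eq_false, not_false_eq_true, and_true, and_false, if_false]
      split_ifs <;> omega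
    · obtain ⟨t, ht⟩ := hv (by simp)
      split_ifs <;> omega
  have h3 : 3 * C.card ≤ ∑ j ∈ C, (T j).card := by
    have := Finset.card_nsmul_le_sum C (fun j => (T j).card) 3 hT3
    simpa [mul_comm] using this
  zify at cA cB hsum h3
  nlinarith

end Predimension

section Cube

variable {V J : Type*}

/-- The algebra of the functions on the cube that depend only on the coordinates in `W`. -/
def juntas (W : Finset V) : Subalgebra ℝ ((V → Bool) → ℝ) where
  carrier := {f | ∀ x y, (∀ v ∈ W, x v = y v) → f x = f y}
  mul_mem' hf hg x y h := by simp only [Pi.mul_apply, hf x y h, hg x y h]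
  add_mem' hf hg x y h := by simp only [Pi.add_apply, hf x y h, hg x y h]
  algebraMap_mem' _ _ _ _ := rfl

theorem juntas_mono {W W' : Finset V} (h : W ⊆ W') : juntas W ≤ juntas W' :=
  fun _ hf x y hxy => hf x y fun v hv => hxy v (h hv)

/-- The character of the cube attached to a set of coordinates. -/
noncomputable def cubeChar (T : Finset V) (x : V → Bool) : ℝ := ∏ v ∈ T, sgn (x v)

theorem cubeChar_mem_juntas (T : Finset V) : cubeChar T ∈ juntas T := fun x y h =>
  Finset.prod_congr rfl fun v hv => by rw [h v hv]

/-- The functions spanned by the characters of weight at least three within `U`. -/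
def highWeight (U : Finset V) : Submodule ℝ ((V → Bool) → ℝ) :=
  Submodule.span ℝ {f | ∃ T ⊆ U, 3 ≤ T.card ∧ f = cubeChar T}

theorem highWeight_le_juntas {U W : Finset V} (h : U ⊆ W) {f : (V → Bool) → ℝ}
    (hf : f ∈ highWeight U) : f ∈ juntas W := by
  have : highWeight U ≤ Subalgebra.toSubmodule (juntas W) := by
    refine Submodule.span_le.2 ?_
    rintro _ ⟨T, hT, -, rfl⟩
    exact juntas_mono (hT.trans h) (cubeChar_mem_juntas T)
  exact this hf

theorem sgn_not (b : Bool) : sgn (!b) = -sgn b := by cases b <;> simp [sgn]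

variable [DecidableEq V]

/-- Flipping one coordinate of the cube. -/
def flipCoord (v : V) (x : V → Bool) : V → Bool := Function.update x v (!x v)

theorem flipCoord_involutive (v : V) : Function.Involutive (flipCoord v) := by
  intro x; simp [flipCoord]

theorem cubeChar_flipCoord (T : Finset V) (v : V) (x : V → Bool) :
    cubeChar T (flipCoord v x) = (if v ∈ T then -1 else 1) * cubeChar T x := by
  have h : ∀ u, sgn (flipCoord v x u) = (if v = u then -1 else 1) * sgn (x u) := by
    intro u
    by_cases huv : v = u
    · subst huv; simp [flipCoord, sgn_not]
    · simp [flipCoord, huv, Function.update_of_ne (Ne.symm huv)]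
  simp only [cubeChar, h, Finset.prod_mul_distrib, Finset.prod_ite_eq]

variable [Fintype V]

theorem sum_mul_prod_cubeChar_eq_zero {W : Finset V} {g : (V → Bool) → ℝ} (hg : g ∈ juntas W)
    {v : V} (hv : v ∉ W) (C : Finset J) (T : J → Finset V)
    (hodd : Odd (C.filter fun j => v ∈ T j).card) :
    ∑ x, g x * ∏ j ∈ C, cubeChar (T j) x = 0 := by
  have hflip : ∀ x, g (flipCoord v x) * ∏ j ∈ C, cubeChar (T j) (flipCoord v x) =
      -(g x * ∏ j ∈ C, cubeChar (T j) x) := by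
    intro x
    have h1 : g (flipCoord v x) = g x := hg _ _ fun u hu => by
      have : u ≠ v := fun h => hv (h ▸ hu)
      simp [flipCoord, this]
    have h2 : ∏ j ∈ C, (if v ∈ T j then (-1 : ℝ) else 1) = -1 := by
      rw [Finset.prod_ite]; simp [hodd.neg_one_pow]
    simp only [cubeChar_flipCoord, Finset.prod_mul_distrib, h1, h2]
    ring
  have h := Equiv.sum_comp (flipCoord_involutive v).toPerm
    fun x => g x * ∏ j ∈ C, cubeChar (T j) x
  simp only [Function.Involutive.coe_toPerm, hflip, Finset.sum_neg_distrib] at h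
  linarith

variable [DecidableEq J]

/-- No set of at most `r` constraints outside `C₀` has all its variables outside `W` covered an
even number of times, where each constraint covers at least three variables of its scope. -/
def NoEvenCover (S : J → Finset V) (r : ℕ) (W : Finset V) (C₀ : Finset J) : Prop :=
  ∀ C : Finset J, C.Nonempty → Disjoint C C₀ → C.card ≤ r → ∀ T : J → Finset V,
    (∀ j ∈ C, T j ⊆ S j) → (∀ j ∈ C, 3 ≤ (T j).card) →
      ∃ v ∉ W, Odd (C.filter fun j => v ∈ T j).card

open scoped Pointwise in
theorem sum_mul_prod_highWeight_eq_zero {S : J → Finset V} {f : J → (V → Bool) → ℝ}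
    (hf : ∀ j, f j ∈ highWeight (S j)) {W : Finset V} {g : (V → Bool) → ℝ} (hg : g ∈ juntas W)
    {C : Finset J}
    (hodd : ∀ T : J → Finset V, (∀ j ∈ C, T j ⊆ S j) → (∀ j ∈ C, 3 ≤ (T j).card) →
      ∃ v ∉ W, Odd (C.filter fun j => v ∈ T j).card) :
    ∑ x, g x * (∏ j ∈ C, f j) x = 0 := by
  have hmem : ∏ j ∈ C, f j ∈ Submodule.span ℝ
      (∏ j ∈ C, {f : (V → Bool) → ℝ | ∃ T ⊆ S j, 3 ≤ T.card ∧ f = cubeChar T}) := by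
    rw [← Submodule.prod_span]
    clear hodd
    induction C using Finset.induction_on with
    | empty => simp [Submodule.one_le.1 le_rfl]
    | insert j C hj ih =>
      rw [Finset.prod_insert hj, Finset.prod_insert hj]
      exact Submodule.mul_mem_mul (hf j) ih
  generalize ∏ j ∈ C, f j = p at hmem
  induction hmem using Submodule.span_induction with
  | mem h hh =>
    obtain ⟨q, hq, rfl⟩ := (Set.mem_finsetProd _ _ _).1 hh
    choose! T hT hT3 hqT using fun j (hj : j ∈ C) => hq hj
    obtain ⟨v, hv, hvodd⟩ := hodd T hT hT3
    rw [← sum_mul_prod_cubeChar_eq_zero hg hv C T hvodd]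
    refine Finset.sum_congr rfl fun x _ => ?_
    rw [Finset.prod_apply, Finset.prod_congr rfl fun j hj => by rw [hqT j hj]]
  | zero => simp
  | add a b _ _ ha hb => simp [mul_add, Finset.sum_add_distrib, ha, hb]
  | smul t a _ ha =>
    simp only [Pi.smul_apply, smul_eq_mul, mul_left_comm _ t, ← Finset.mul_sum, ha, mul_zero]

variable [Fintype J]

/-- The mean of `g` against the expansion of `∏ (1 + f j)`, truncated to products of at most `r`
factors `f j`. -/
noncomputable def pseudoMean (f : J → (V → Bool) → ℝ) (r : ℕ) :
    ((V → Bool) → ℝ) →ₗ[ℝ] ℝ where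
  toFun g := (∑ x, g x * ∑ C : Finset J with C.card ≤ r, (∏ j ∈ C, f j) x) /
    (Fintype.card (V → Bool) : ℝ)
  map_add' a b := by simp only [Pi.add_apply, add_mul, Finset.sum_add_distrib, add_div]
  map_smul' t a := by
    simp only [Pi.smul_apply, smul_eq_mul, mul_assoc, ← Finset.mul_sum, mul_div_assoc,
      RingHom.id_apply]

/-- On the functions of `W`, the pseudomean is the mean against the density given by `C₀`. -/
theorem pseudoMean_eq {S : J → Finset V} {f : J → (V → Bool) → ℝ}
    (hf : ∀ j, f j ∈ highWeight (S j)) {r : ℕ} {W : Finset V} {C₀ : Finset J}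
    (hCW : ∀ j ∈ C₀, S j ⊆ W) (hC₀ : C₀.card ≤ r) (hW : NoEvenCover S r W C₀)
    {g : (V → Bool) → ℝ} (hg : g ∈ juntas W) :
    pseudoMean f r g =
      (∑ x, g x * (∏ j ∈ C₀, (1 + f j)) x) / (Fintype.card (V → Bool) : ℝ) := by
  have hexpand : ∏ j ∈ C₀, (1 + f j) = ∑ C ∈ C₀.powerset, ∏ j ∈ C, f j :=
    Finset.prod_one_add C₀
  have hsub : C₀.powerset ⊆ Finset.univ.filter fun C : Finset J => C.card ≤ r := by
    intro C hC
    simpa using (Finset.card_le_card (Finset.mem_powerset.1 hC)).trans hC₀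
  simp only [pseudoMean, LinearMap.coe_mk, AddHom.coe_mk]
  congr 1
  rw [hexpand]
  simp only [Finset.sum_apply, Finset.mul_sum]
  rw [Finset.sum_comm, Finset.sum_comm (s := Finset.univ) (t := C₀.powerset)]
  refine (Finset.sum_subset hsub fun C hC hCn => ?_).symm
  rw [← Finset.sum_congr rfl fun x _ => by
    rw [← Finset.prod_inter_mul_prod_sdiff C C₀ f, Pi.mul_apply, ← mul_assoc]]
  refine sum_mul_prod_highWeight_eq_zero hf (W := W)
    (g := g * ∏ j ∈ C ∩ C₀, f j) ?_ ?_
  · refine mul_mem hg (prod_mem fun j hj => ?_)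
    exact highWeight_le_juntas (hCW j (Finset.mem_inter.1 hj).2) (hf j)
  · refine hW (C \ C₀) ?_ Finset.sdiff_disjoint ?_
    · rw [Finset.sdiff_nonempty]
      simpa using hCn
    · exact (Finset.card_le_card Finset.sdiff_subset).trans (by simpa using hC)

/-- Averaging over the coordinates outside `W` does not change the mean against a function
of `W`. -/
theorem exists_junta_average {W W' : Finset V} {G : (V → Bool) → ℝ} (hG : G ∈ juntas W') :
    ∃ G' ∈ juntas (W ∩ W'), ∀ φ ∈ juntas W, ∑ x, φ x * G x = ∑ x, φ x * G' x := by
  let mix : (V → Bool) → (V → Bool) → V → Bool := fun x z v => if v ∈ W then x v else z v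
  refine ⟨fun x => (∑ z, G (mix x z)) / (Fintype.card (V → Bool) : ℝ), ?_, ?_⟩
  · intro x y h
    refine congrArg (· / _) (Finset.sum_congr rfl fun z _ => hG _ _ fun v hv => ?_)
    by_cases hvW : v ∈ W
    · simp [mix, hvW, h v (Finset.mem_inter.2 ⟨hvW, hv⟩)]
    · simp [mix, hvW]
  · intro φ hφ
    have hinv : Function.Involutive fun p : (V → Bool) × (V → Bool) =>
        (mix p.1 p.2, mix p.2 p.1) := by
      intro p
      ext v <;> by_cases hv : v ∈ W <;> simp [mix, hv]
    have h := Equiv.sum_comp hinv.toPerm fun p : (V → Bool) × (V → Bool) => φ p.1 * G p.1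
    simp only [Function.Involutive.coe_toPerm, Fintype.sum_prod_type, Finset.sum_const,
      Finset.card_univ, nsmul_eq_mul, ← Finset.mul_sum] at h
    have hmix : ∀ x z, φ (mix x z) = φ x := fun x z => hφ _ _ fun v hv => by simp [mix, hv]
    simp only [hmix, ← Finset.mul_sum] at h
    have hne : (Fintype.card (V → Bool) : ℝ) ≠ 0 := by
      exact_mod_cast Fintype.card_ne_zero
    simp only [← mul_div_assoc, ← Finset.sum_div]
    rw [h, mul_div_cancel_left₀ _ hne]

end Cube

section Projection

/-- Orthogonal projection onto a subspace for the (possibly degenerate) inner product given by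
nonnegative weights. -/
theorem exists_weighted_projection {X : Type*} [Fintype X] (w : X → ℝ) (hw : ∀ x, 0 ≤ w x)
    (U : Submodule ℝ (X → ℝ)) (f : X → ℝ) :
    ∃ h ∈ U, ∀ g ∈ U, ∑ x, (f x - h x) * g x * w x = 0 := by
  let Φ : (X → ℝ) →ₗ[ℝ] EuclideanSpace ℝ X :=
    { toFun := fun g => WithLp.toLp 2 fun x => Real.sqrt (w x) * g x
      map_add' := fun a b => by ext x; simp [mul_add]
      map_smul' := fun t a => by ext x; simp [mul_left_comm] }
  obtain ⟨y, hy, z, hz, hyz⟩ := Submodule.exists_add_mem_mem_orthogonal (K := U.map Φ) (Φ f)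
  obtain ⟨h, hh, rfl⟩ := Submodule.mem_map.1 hy
  refine ⟨h, hh, fun g hg => ?_⟩
  have hz' := (Submodule.mem_orthogonal _ _).1 hz (Φ g) (Submodule.mem_map_of_mem hg)
  have hzeq : z = Φ (f - h) := by rw [map_sub, hyz, add_sub_cancel_left]
  rw [hzeq, PiLp.inner_apply] at hz'
  rw [← hz']
  refine Finset.sum_congr rfl fun x _ => ?_
  have := Real.mul_self_sqrt (hw x)
  simp only [Φ, LinearMap.coe_mk, AddHom.coe_mk, Pi.sub_apply, RCLike.inner_apply, conj_trivial]
  linear_combination -(f x - h x) * g x * this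

end Projection

section Positivity

/-- A linear functional that is positive on each member of a family of subspaces closed under
intersections is positive on their span, provided that any two members are orthogonal relative to
their intersection. -/
theorem nonneg_of_relatively_orthogonal {ι R : Type*} [SemilatticeInf ι] [Finite ι] [CommRing R]
    [Algebra ℝ R] (L : R →ₗ[ℝ] ℝ) (F : ι → Submodule ℝ R) (hF : Monotone F) (s : Finset ι)
    (hinf : ∀ a ∈ s, ∀ b ∈ s, a ⊓ b ∈ s)
    (hpos : ∀ a ∈ s, ∀ f ∈ F a, 0 ≤ L (f * f))
    (hproj : ∀ a ∈ s, ∀ U ≤ F a, ∀ f ∈ F a, ∃ h ∈ U, ∀ g ∈ U, L ((f - h) * g) = 0)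
    (horth : ∀ a ∈ s, ∀ b ∈ s, ∀ f ∈ F a, (∀ h ∈ F (a ⊓ b), L (f * h) = 0) →
      ∀ g ∈ F b, L (f * g) = 0)
    {p : R} (hp : p ∈ ⨆ a ∈ s, F a) : 0 ≤ L (p * p) := by
  classical
  let F₀ : ι → Submodule ℝ R := fun a =>
    { carrier := {f | f ∈ F a ∧ ∀ b ∈ s, b < a → ∀ h ∈ F b, L (f * h) = 0}
      add_mem' := fun {x y} hx hy => ⟨add_mem hx.1 hy.1, fun b hb hba h hh => by
        rw [add_mul, map_add, hx.2 b hb hba h hh, hy.2 b hb hba h hh, add_zero]⟩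
      zero_mem' := ⟨zero_mem _, fun b _ _ h _ => by rw [zero_mul, map_zero]⟩
      smul_mem' := fun t x hx => ⟨Submodule.smul_mem _ _ hx.1, fun b hb hba h hh => by
        rw [smul_mul_assoc, map_smul, hx.2 b hb hba h hh, smul_zero]⟩ }
  have hspan : ∀ a ∈ s, F a ≤ ⨆ b ∈ s, F₀ b := by
    intro a
    induction a using WellFoundedLT.induction with
    | ind a ih =>
      intro ha f hf
      obtain ⟨h, hh, hhorth⟩ := hproj a ha (⨆ b ∈ s.filter (· < a), F b)
        (iSup₂_le fun b hb => hF (Finset.mem_filter.1 hb).2.le) f hf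
      have hha : h ∈ F a :=
        (iSup₂_le fun b hb => hF (Finset.mem_filter.1 hb).2.le :
          ⨆ b ∈ s.filter (· < a), F b ≤ F a) hh
      have h1 : f - h ∈ F₀ a := ⟨sub_mem hf hha, fun b hb hba g hg =>
        hhorth g (Submodule.mem_iSup_of_mem b
          (Submodule.mem_iSup_of_mem (Finset.mem_filter.2 ⟨hb, hba⟩) hg))⟩
      have h2 : h ∈ ⨆ b ∈ s, F₀ b :=
        (iSup₂_le fun b hb => ih b (Finset.mem_filter.1 hb).2 (Finset.mem_filter.1 hb).1 :
          ⨆ b ∈ s.filter (· < a), F b ≤ ⨆ b ∈ s, F₀ b) hh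
      rw [← sub_add_cancel f h]
      exact add_mem (Submodule.mem_iSup_of_mem a (Submodule.mem_iSup_of_mem ha h1)) h2
  have hp₀ : p ∈ ⨆ a ∈ s, F₀ a := (iSup₂_le hspan : ⨆ a ∈ s, F a ≤ _) hp
  obtain ⟨q, rfl⟩ := (Submodule.mem_iSup_finset_iff_exists_sum _ _).1 hp₀
  have hzero : ∀ a ∈ s, ∀ b ∈ s, a ≠ b → L ((q a : R) * q b) = 0 := by
    have aux : ∀ a ∈ s, ∀ b ∈ s, a ⊓ b < a → L ((q a : R) * q b) = 0 := fun a ha b hb hlt =>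
      horth a ha b hb _ (q a).2.1 (fun h hh => (q a).2.2 _ (hinf a ha b hb) hlt h hh) _ (q b).2.1
    intro a ha b hb hab
    by_cases h : a ⊓ b < a
    · exact aux a ha b hb h
    · rw [mul_comm]
      refine aux b hb a ha (lt_of_le_of_ne inf_le_left fun h' => h ?_)
      rw [inf_comm, h']
      refine lt_of_le_of_ne ?_ hab.symm
      rw [← h']; exact inf_le_right
  rw [Finset.sum_mul_sum, map_sum]
  refine Finset.sum_nonneg fun a ha => ?_
  rw [map_sum, Finset.sum_eq_single_of_mem a ha fun b hb hba => hzero a ha b hb hba.symm]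
  exact hpos a ha _ (q a).2.1

variable {V J : Type*} [DecidableEq V] [DecidableEq J]

theorem SelfSufficient.noEvenCover [Fintype V] {S : J → Finset V} {k r : ℕ} (hS : ∀ j, (S j).card = k)
    {A B : Finset V × Finset J} (hA : SelfSufficient S k r A) (hB : SelfSufficient S k r B) :
    NoEvenCover S r (A.1 ∪ B.1) (A.2 ∪ B.2) := by
  intro C hC hdisj hr T hT hT3
  rw [Finset.disjoint_union_right] at hdisj
  exact hA.exists_odd_degree hS hB hC hdisj.1 hdisj.2 hr hT hT3

theorem prod_one_add_nonneg {V J : Type*} {f : J → (V → Bool) → ℝ} (hf0 : ∀ j x, 0 ≤ 1 + f j x)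
    (C : Finset J) (x : V → Bool) : 0 ≤ (∏ j ∈ C, (1 + f j)) x := by
  rw [Finset.prod_apply]
  exact Finset.prod_nonneg fun j _ => hf0 j x

/-- The pseudomean of a square is nonnegative on the span of the functions of few variables. -/
theorem pseudoMean_mul_self_nonneg [Fintype V] [Fintype J] {S : J → Finset V} {k r s₀ d : ℕ}
    (hS : ∀ j, (S j).card = k)
    {f : J → (V → Bool) → ℝ} (hf : ∀ j, f j ∈ highWeight (S j)) (hf0 : ∀ j x, 0 ≤ 1 + f j x)
    (hr : 2 * s₀ ≤ r)
    (hexp : ∀ C : Finset J, C.card ≤ s₀ + r →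
      2 * ((C.biUnion S).card : ℤ) - (2 * (k : ℤ) - 3) * C.card ≤ 2 * d → C.card ≤ s₀)
    {p : (V → Bool) → ℝ}
    (hp : p ∈ Submodule.span ℝ {g | ∃ W : Finset V, W.card ≤ d ∧ g ∈ juntas W}) :
    0 ≤ pseudoMean f r (p * p) := by
  classical
  have hcard : (0 : ℝ) < (Fintype.card (V → Bool) : ℝ) := by
    exact_mod_cast Fintype.card_pos
  let s : Finset (Finset V × Finset J) :=
    Finset.univ.filter fun A => SelfSufficient S k r A ∧ A.2.card ≤ s₀
  have hs : ∀ A, A ∈ s ↔ SelfSufficient S k r A ∧ A.2.card ≤ s₀ := fun A => by simp [s]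
  have hmean₂ : ∀ A ∈ s, ∀ B ∈ s, ∀ g ∈ juntas (A.1 ∪ B.1), pseudoMean f r g =
      (∑ x, g x * (∏ j ∈ A.2 ∪ B.2, (1 + f j)) x) / (Fintype.card (V → Bool) : ℝ) := by
    intro A hA B hB g hg
    rw [hs] at hA hB
    refine pseudoMean_eq hf (W := A.1 ∪ B.1) ?_ ?_ (hA.1.noEvenCover hS hB.1) hg
    · exact (hA.1.1.sup hB.1.1)
    · have := Finset.card_union_le A.2 B.2
      omega
  have hmean : ∀ A ∈ s, ∀ g ∈ juntas A.1, pseudoMean f r g =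
      (∑ x, g x * (∏ j ∈ A.2, (1 + f j)) x) / (Fintype.card (V → Bool) : ℝ) := by
    intro A hA g hg
    have := hmean₂ A hA A hA g (by rwa [Finset.union_self])
    rwa [Finset.union_self] at this
  refine nonneg_of_relatively_orthogonal (pseudoMean f r)
    (fun A : Finset V × Finset J => Subalgebra.toSubmodule (juntas A.1))
    (fun A B hAB => juntas_mono (Prod.le_def.1 hAB).1) s ?_ ?_ ?_ ?_ ?_
  · intro A hA B hB
    rw [hs] at hA hB ⊢
    exact ⟨hA.1.inf hB.1, (Finset.card_le_card Finset.inter_subset_left).trans hA.2⟩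
  · intro A hA g hg
    rw [hmean A hA _ (mul_mem hg hg)]
    exact div_nonneg (Finset.sum_nonneg fun x _ => mul_nonneg (mul_self_nonneg _)
      (prod_one_add_nonneg hf0 _ _)) hcard.le
  · intro A hA U hU g hg
    obtain ⟨h, hh, horth⟩ := exists_weighted_projection _ (prod_one_add_nonneg hf0 A.2) U g
    refine ⟨h, hh, fun q hq => ?_⟩
    rw [hmean A hA _ (mul_mem (sub_mem hg (hU hh)) (hU hq))]
    simp only [Pi.mul_apply, Pi.sub_apply, horth q hq, zero_div]
  · intro A hA B hB g hg hg0 q hq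
    have hA' := (hs A).1 hA
    have hB' := (hs B).1 hB
    obtain ⟨Q, hQ, hQeq⟩ := exists_junta_average (W := A.1)
      (G := q * ∏ j ∈ B.2 \ A.2, (1 + f j)) (W' := B.1) (mul_mem hq (prod_mem fun j hj =>
        add_mem (one_mem _) (highWeight_le_juntas (hB'.1.1 j (Finset.mem_sdiff.1 hj).1) (hf j))))
    have hgA : g * ∏ j ∈ A.2, (1 + f j) ∈ juntas A.1 := mul_mem hg (prod_mem fun j hj =>
      add_mem (one_mem _) (highWeight_le_juntas (hA'.1.1 j hj) (hf j)))
    have h0 := hg0 Q hQ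
    rw [hmean A hA _ (mul_mem hg (juntas_mono Finset.inter_subset_left hQ))] at h0
    rw [hmean₂ A hA B hB _ (mul_mem (juntas_mono Finset.subset_union_left hg)
      (juntas_mono Finset.subset_union_right hq)), ← h0]
    congr 1
    have h1 := hQeq _ hgA
    rw [← Finset.union_sdiff_self_eq_union, Finset.prod_union Finset.disjoint_sdiff]
    simp only [Pi.mul_apply] at h1 ⊢
    calc _ = _ := Finset.sum_congr rfl fun x _ => by ring
      _ = _ := h1
      _ = _ := Finset.sum_congr rfl fun x _ => by ring
  · refine (Submodule.span_le.2 ?_ : Submodule.span ℝ _ ≤ _) hp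
    rintro g ⟨W, hW, hg⟩
    obtain ⟨A, hA, hA0, hWA⟩ := exists_selfSufficient hexp W hW
    exact Submodule.mem_iSup_of_mem A (Submodule.mem_iSup_of_mem ((hs A).2 ⟨hA, hA0⟩)
      (juntas_mono hWA hg))

end Positivity

section LocalCover

variable {V J : Type*} [Fintype V] [DecidableEq V]

theorem two_mul_card_sdiff_add_sum_degree_le {C : Finset J} {T : J → Finset V} {W : Finset V}
    (h : ∀ v ∉ W, Even (C.filter fun j => v ∈ T j).card) :
    2 * (C.biUnion T \ W).card + ∑ v ∈ W, (C.filter fun j => v ∈ T j).card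
      ≤ ∑ j ∈ C, (T j).card := by
  rw [sum_card_eq_sum_degree C T, ← Finset.sum_add_sum_compl W, add_comm]
  refine Nat.add_le_add_left ?_ _
  have hsub : C.biUnion T \ W ⊆ Wᶜ := fun v hv => by
    simpa using (Finset.mem_sdiff.1 hv).2
  refine le_trans ?_ (Finset.sum_le_sum_of_subset hsub)
  rw [mul_comm, ← smul_eq_mul, ← Finset.sum_const]
  refine Finset.sum_le_sum fun v hv => ?_
  obtain ⟨hv1, hv2⟩ := Finset.mem_sdiff.1 hv
  have h1 := (mem_biUnion_iff_degree_pos C T v).1 hv1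
  obtain ⟨t, ht⟩ := h v hv2
  omega

theorem noEvenCover_empty {S : J → Finset V} {k r s : ℕ} (hS : ∀ j, (S j).card = k)
    (hrs : r ≤ s)
    (hpos : ∀ C : Finset J, C.Nonempty → C.card ≤ s →
      2 * k * C.card < 2 * (C.biUnion S).card + 3 * C.card) :
    NoEvenCover S r ∅ ∅ := by
  intro C hC _ hr T hT hT3
  by_contra! hcon
  have h1 := two_mul_card_sdiff_add_sum_degree_le (W := ∅) (C := C) (T := T)
    fun v hv => by simpa using hcon v hv
  have h2 := card_biUnion_scopes_sdiff_le hS C hT ∅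
  have h3 : C.card * 3 ≤ ∑ j ∈ C, (T j).card := by
    simpa using Finset.card_nsmul_le_sum C (fun j => (T j).card) 3 hT3
  have h4 := hpos C hC (hr.trans hrs)
  simp only [Finset.sdiff_empty, Finset.sum_empty] at h1 h2
  nlinarith

theorem noEvenCover_singleton [DecidableEq J] {S : J → Finset V} {k r s : ℕ} (hS : ∀ j, (S j).card = k)
    (hrs : r + 1 ≤ s)
    (hpos : ∀ C : Finset J, C.Nonempty → C.card ≤ s →
      2 * k * C.card < 2 * (C.biUnion S).card + 3 * C.card)
    (hsmall : ∀ C : Finset J, 3 ≤ C.card → C.card ≤ s →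
      2 * k * C.card + 2 < 2 * (C.biUnion S).card + 3 * C.card) (j : J) :
    NoEvenCover S r (S j) {j} := by
  intro C hC hdisj hr T hT hT3
  by_contra! hcon
  have hjC : j ∉ C := by simpa using hdisj
  have h1 := two_mul_card_sdiff_add_sum_degree_le (W := S j) (C := C) (T := T)
    fun v hv => by simpa using hcon v hv
  have h2 := card_biUnion_scopes_sdiff_le hS C hT (S j)
  have h3 : C.card * 3 ≤ ∑ j ∈ C, (T j).card := by
    simpa using Finset.card_nsmul_le_sum C (fun j => (T j).card) 3 hT3
  have hins : ((insert j C).biUnion S).card = (C.biUnion S \ S j).card + k := by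
    rw [Finset.biUnion_insert, ← Finset.union_sdiff_self_eq_union,
      Finset.card_union_of_disjoint Finset.disjoint_sdiff, hS, add_comm]
  have hcard : (insert j C).card = C.card + 1 := Finset.card_insert_of_notMem hjC
  have hins0 : (insert j C).Nonempty := Finset.insert_nonempty j C
  rcases Nat.eq_zero_or_pos (∑ v ∈ S j, (C.filter fun j => v ∈ T j).card) with h0 | h0
  · have h4 := hpos C hC (by omega)
    have h5 := card_biUnion_scopes_sdiff_le hS C hT ∅
    have h6 : C.biUnion T \ S j = C.biUnion T := by
      refine Finset.sdiff_eq_self_of_disjoint (Finset.disjoint_left.2 fun v hv hvj => ?_)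
      have := (mem_biUnion_iff_degree_pos C T v).1 hv
      have := Finset.sum_eq_zero_iff.1 h0 v hvj
      omega
    rw [h6] at h1
    simp only [Finset.sdiff_empty] at h5
    nlinarith
  · have hC1 := hC.card_pos
    rcases Nat.lt_or_ge C.card 2 with hc | hc
    · have h4 := hpos _ hins0 (by omega)
      have h5 : C.biUnion T \ S j = ∅ := by
        refine Finset.eq_empty_of_forall_notMem fun v hv => ?_
        obtain ⟨hv1, hv2⟩ := Finset.mem_sdiff.1 hv
        have h6 := (mem_biUnion_iff_degree_pos C T v).1 hv1
        have h7 : Even (C.filter fun j => v ∈ T j).card := by simpa using hcon v hv2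
        obtain ⟨t, ht⟩ := h7
        have := Finset.card_filter_le C fun j => v ∈ T j
        omega
      rw [h5, Finset.card_empty] at h2
      rw [hins, hcard] at h4
      have hc1 : C.card = 1 := by omega
      rw [hc1] at h2 h3 h4
      omega
    · have h4 := hsmall (insert j C) (by omega) (by omega)
      rw [hins, hcard] at h4
      nlinarith

end LocalCover

section Rows

/-- The weight, under the distribution `nuC`, of a pattern of signs of the rows. -/
noncomputable def rowWeight (c : ℕ) (ε : Fin (c ^ 2) → Bool) : ℝ :=
  ((if (Finset.univ.filter fun l => ε l = true).card = c * (c - 1) / 2 + c then 1 else 0)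
    + (if (Finset.univ.filter fun l => ε l = false).card = c * (c - 1) / 2 + c then 1 else 0))
    * ((1 / 2 : ℝ) * (1 / (((c ^ 2).choose (c * (c - 1) / 2 + c) : ℕ) : ℝ))
        * (1 / 4 : ℝ) ^ (c ^ 2))

/-- The sum of `φ` over the strings of length four whose sum is `2` or `-2`, according to `b`. -/
noncomputable def sumRow (b : Bool) (φ : (Fin 4 → Bool) → ℝ) : ℝ :=
  ∑ x : Fin 4 → Bool,
    (if ∑ i, (if x i then (1 : ℤ) else -1) = (if b then 2 else -2) then 1 else 0) * φ x

theorem nuC_eq_sum (c : ℕ) (M : Fin (c ^ 2) × Fin 4 → Bool) :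
    nuC c M = ∑ ε, rowWeight c ε *
      ∏ l, (if rowSum M l = (if ε l then 2 else -2) then (1 : ℝ) else 0) := by
  classical
  have hprod : ∀ ε : Fin (c ^ 2) → Bool,
      ∏ l, (if rowSum M l = (if ε l then 2 else -2) then (1 : ℝ) else 0) =
        if ∀ l, rowSum M l = (if ε l then 2 else -2) then 1 else 0 := fun ε => by
    rw [Finset.prod_ite_zero]; simp
  simp only [hprod]
  unfold nuC
  by_cases h : ∀ l, rowSum M l = 2 ∨ rowSum M l = -2
  · rw [if_pos h]
    have hε : ∀ ε : Fin (c ^ 2) → Bool, (∀ l, rowSum M l = (if ε l then 2 else -2)) ↔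
        ε = fun l => decide (rowSum M l = 2) := by
      intro ε
      rw [funext_iff]
      refine forall_congr' fun l => ?_
      rcases h l with h' | h' <;> cases hb : ε l <;> simp [h']
    simp only [hε, mul_ite, mul_one, mul_zero, Finset.sum_ite_eq', Finset.mem_univ, if_true]
    have h2 : (Finset.univ.filter fun l => decide (rowSum M l = 2) = false) =
        Finset.univ.filter fun l => rowSum M l = -2 := by
      refine Finset.filter_congr fun l _ => ?_
      rcases h l with h' | h' <;> simp [h']
    simp only [rowWeight, decide_eq_true_eq, h2]
    split_ifs <;> ring
  · rw [if_neg h]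
    symm
    refine Finset.sum_eq_zero fun ε _ => ?_
    rw [if_neg, mul_zero]
    intro h'
    refine h fun l => ?_
    have := h' l
    cases hb : ε l <;> simp [hb] at this <;> simp [this]

theorem sum_nuC_mul_prod (c : ℕ) (g : Fin (c ^ 2) → (Fin 4 → Bool) → ℝ) :
    ∑ M, nuC c M * ∏ l, g l (fun i => M (l, i)) =
      ∑ ε, rowWeight c ε * ∏ l, sumRow (ε l) (g l) := by
  classical
  simp only [nuC_eq_sum, Finset.sum_mul]
  rw [Finset.sum_comm]
  refine Finset.sum_congr rfl fun ε _ => ?_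
  simp only [mul_assoc, ← Finset.mul_sum, ← Finset.prod_mul_distrib]
  congr 1
  simp only [sumRow]
  rw [Finset.prod_univ_sum, Fintype.piFinset_univ]
  exact Fintype.sum_equiv (Equiv.curry _ _ _) _ _ fun M => rfl

theorem sumRow_one (b : Bool) : sumRow b (fun _ => 1) = 4 := by
  have h : ∀ b : Bool, (∑ x : Fin 4 → Bool,
    (if ∑ i, (if x i then (1 : ℤ) else -1) = (if b then 2 else -2) then (1 : ℤ) else 0) * 1)
      = 4 := by decide
  unfold sumRow
  have := congrArg (Int.cast : ℤ → ℝ) (h b)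
  push_cast at this
  exact this

theorem sumRow_sgn (b : Bool) (i : Fin 4) : sumRow b (fun x => sgn (x i)) = 2 * sgn b := by
  have h : ∀ b : Bool, ∀ j, (∑ x : Fin 4 → Bool,
    (if ∑ i, (if x i then (1 : ℤ) else -1) = (if b then 2 else -2) then (1 : ℤ) else 0) *
      (if x j then 1 else -1)) = 2 * (if b then 1 else -1) := by decide
  unfold sumRow sgn
  have := congrArg (Int.cast : ℤ → ℝ) (h b i)
  push_cast at this
  exact this

theorem sumRow_sgn_mul_sgn (b : Bool) {i i' : Fin 4} (hi : i ≠ i') :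
    sumRow b (fun x => sgn (x i) * sgn (x i')) = 0 := by
  have h : ∀ b : Bool, ∀ j j', j ≠ j' → (∑ x : Fin 4 → Bool,
    (if ∑ i, (if x i then (1 : ℤ) else -1) = (if b then 2 else -2) then (1 : ℤ) else 0) *
      ((if x j then 1 else -1) * (if x j' then 1 else -1))) = 0 := by decide
  unfold sumRow sgn
  have := congrArg (Int.cast : ℤ → ℝ) (h b i i' hi)
  push_cast at this
  exact this

end Rows

section RowWeight

theorem rowWeight_nonneg (c : ℕ) (ε : Fin (c ^ 2) → Bool) : 0 ≤ rowWeight c ε := by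
  unfold rowWeight
  refine mul_nonneg (add_nonneg ?_ ?_) (by positivity) <;> split_ifs <;> norm_num

theorem rowWeight_not (c : ℕ) (ε : Fin (c ^ 2) → Bool) :
    rowWeight c (fun l => !ε l) = rowWeight c ε := by
  simp only [rowWeight, Bool.not_eq_true', Bool.not_eq_false', add_comm]

theorem rowWeight_comp (c : ℕ) (ε : Fin (c ^ 2) → Bool) (σ : Equiv.Perm (Fin (c ^ 2))) :
    rowWeight c (ε ∘ σ) = rowWeight c ε := by
  have h : ∀ b, (Finset.univ.filter fun l => (ε ∘ σ) l = b).card =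
      (Finset.univ.filter fun l => ε l = b).card := fun b =>
    Finset.card_equiv σ (by simp)
  simp only [rowWeight, h]

theorem card_filter_bool_eq {α : Type*} [Fintype α] [DecidableEq α] (b : Bool) (p : ℕ) :
    (Finset.univ.filter fun ε : α → Bool => (Finset.univ.filter fun l => ε l = b).card = p).card
      = (Fintype.card α).choose p := by
  classical
  rw [← Finset.card_univ, ← Finset.card_powersetCard]
  refine Finset.card_bij' (fun ε _ => Finset.univ.filter fun l => ε l = b)
    (fun A _ l => if l ∈ A then b else !b) ?_ ?_ ?_ ?_
  · intro ε hε
    simpa [Finset.mem_powersetCard] using hε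
  · intro A hA
    rw [Finset.mem_powersetCard] at hA
    simp [hA.2]
  · intro ε hε
    funext l
    cases hb : ε l <;> cases b <;> simp [hb]
  · intro A hA
    ext l; by_cases h : l ∈ A <;> simp [h]

theorem two_mul_rows {c : ℕ} (hc : 1 ≤ c) : 2 * (c * (c - 1) / 2 + c) = c ^ 2 + c := by
  obtain ⟨t, rfl⟩ : ∃ t, c = t + 1 := ⟨c - 1, by omega⟩
  have h : 2 * ((t + 1) * t / 2) = (t + 1) * t := by
    have := Nat.even_mul_succ_self t
    exact Nat.two_mul_div_two_of_even (by rwa [mul_comm] at this)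
  simp only [Nat.add_sub_cancel]
  nlinarith

theorem sum_rowWeight {c : ℕ} (hc : 1 ≤ c) : ∑ ε, rowWeight c ε = (1 / 4 : ℝ) ^ (c ^ 2) := by
  have hp : c * (c - 1) / 2 + c ≤ c ^ 2 := by
    have := two_mul_rows hc
    nlinarith
  have h0 : (((c ^ 2).choose (c * (c - 1) / 2 + c) : ℕ) : ℝ) ≠ 0 := by
    exact_mod_cast (Nat.choose_pos hp).ne'
  simp only [rowWeight]
  rw [← Finset.sum_mul, Finset.sum_add_distrib, Finset.sum_boole, Finset.sum_boole,
    card_filter_bool_eq, card_filter_bool_eq, Fintype.card_fin]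
  field_simp
  ring

theorem sum_sgn_eq {α : Type*} [Fintype α] (ε : α → Bool) (b : Bool) :
    ∑ l, sgn (ε l) = sgn b * (2 * (Finset.univ.filter fun l => ε l = b).card - Fintype.card α) := by
  have h : ∀ l, sgn (ε l) = sgn b * (2 * (if ε l = b then 1 else 0) - 1) := fun l => by
    cases ε l <;> cases b <;> norm_num [sgn]
  simp only [h]
  rw [← Finset.mul_sum, Finset.sum_sub_distrib, ← Finset.mul_sum, Finset.sum_boole]
  simp

theorem sgn_mul_self (b : Bool) : sgn b * sgn b = 1 := by cases b <;> norm_num [sgn]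

theorem rowWeight_mul_sq {c : ℕ} (hc : 1 ≤ c) (ε : Fin (c ^ 2) → Bool) :
    rowWeight c ε * (∑ l, sgn (ε l)) ^ 2 = rowWeight c ε * (c : ℝ) ^ 2 := by
  have h2 : (2 : ℝ) * ((c * (c - 1) / 2 + c : ℕ) : ℝ) = (c : ℝ) ^ 2 + c := by
    exact_mod_cast two_mul_rows hc
  have key : ∀ b, (Finset.univ.filter fun l => ε l = b).card = c * (c - 1) / 2 + c →
      (∑ l, sgn (ε l)) ^ 2 = (c : ℝ) ^ 2 := by
    intro b hb
    rw [sum_sgn_eq ε b, hb, h2, Fintype.card_fin, mul_pow, sq (sgn b), sgn_mul_self]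
    push_cast; ring
  by_cases h : (∑ l, sgn (ε l)) ^ 2 = (c : ℝ) ^ 2
  · rw [h]
  · have : rowWeight c ε = 0 := by
      rw [rowWeight, if_neg fun hb => h (key _ hb), if_neg fun hb => h (key _ hb)]
      ring
    rw [this, zero_mul, zero_mul]

theorem sum_rowWeight_mul_sgn (c : ℕ) (l : Fin (c ^ 2)) :
    ∑ ε, rowWeight c ε * sgn (ε l) = 0 := by
  have h : ∑ ε, rowWeight c ε * sgn (ε l) = ∑ ε, -(rowWeight c ε * sgn (ε l)) := by
    refine Fintype.sum_equiv (Function.Involutive.toPerm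
      (fun (ε : Fin (c ^ 2) → Bool) l => !ε l) fun ε => by simp) _ _ fun ε => ?_
    simp [Function.Involutive.toPerm, rowWeight_not, sgn_not]
  rw [Finset.sum_neg_distrib] at h
  linarith

theorem sum_rowWeight_mul_sgn_mul_sgn {c : ℕ} (hc : 2 ≤ c) {l l' : Fin (c ^ 2)} (hl : l ≠ l') :
    ∑ ε, rowWeight c ε * (sgn (ε l) * sgn (ε l')) = 0 := by
  set q : Fin (c ^ 2) → Fin (c ^ 2) → ℝ := fun l l' =>
    ∑ ε, rowWeight c ε * (sgn (ε l) * sgn (ε l')) with hq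
  have hperm : ∀ (σ : Equiv.Perm (Fin (c ^ 2))) (m m'), q (σ m) (σ m') = q m m' := by
    intro σ m m'
    refine Fintype.sum_equiv (Equiv.arrowCongr σ.symm (Equiv.refl Bool)) _ _ fun ε => ?_
    have : (Equiv.arrowCongr σ.symm (Equiv.refl Bool)) ε = ε ∘ σ := by
      ext; simp [Equiv.arrowCongr]
    rw [this, rowWeight_comp]
    rfl
  have hconst : ∀ m m', m ≠ m' → q m m' = q l l' := by
    intro m m' hm
    have h1 := hperm (Equiv.swap (Equiv.swap l m l') m' * Equiv.swap l m) l l'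
    have h2 : Equiv.swap l m l' ≠ m := fun h => hl.symm (by
      have := congrArg (Equiv.swap l m) h
      simpa using this)
    rw [← h1]
    simp [Equiv.Perm.mul_apply, Equiv.swap_apply_of_ne_of_ne h2.symm hm]
  have hdiag : ∀ m, q m m = ∑ ε, rowWeight c ε := fun m => by
    simp only [hq, sgn_mul_self, mul_one]
  have hsum : ∑ m, ∑ m', q m m' = (c : ℝ) ^ 2 * ∑ ε, rowWeight c ε := by
    rw [Finset.mul_sum]
    calc ∑ m, ∑ m', q m m' = ∑ ε, rowWeight c ε * (∑ l, sgn (ε l)) ^ 2 := by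
          simp only [hq]
          rw [Finset.sum_congr rfl fun m _ => Finset.sum_comm, Finset.sum_comm]
          refine Finset.sum_congr rfl fun ε _ => ?_
          rw [sq (∑ l, sgn (ε l)), Finset.sum_mul_sum, Finset.mul_sum]
          exact Finset.sum_congr rfl fun m _ => by rw [Finset.mul_sum]
      _ = _ := Finset.sum_congr rfl fun ε _ => by
          rw [rowWeight_mul_sq (by omega), mul_comm]
  have hsum' : ∑ m, ∑ m', q m m' =
      (c : ℝ) ^ 2 * (((c : ℝ) ^ 2 - 1) * q l l' + ∑ ε, rowWeight c ε) := by
    have : ∀ m, ∑ m', q m m' = ((c : ℝ) ^ 2 - 1) * q l l' + ∑ ε, rowWeight c ε := by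
      intro m
      rw [← Finset.sum_erase_add _ _ (Finset.mem_univ m), hdiag,
        Finset.sum_congr rfl fun m' hm' => hconst m m' (Finset.ne_of_mem_erase hm').symm,
        Finset.sum_const, Finset.card_erase_of_mem (Finset.mem_univ m), Finset.card_univ,
        Fintype.card_fin, nsmul_eq_mul, Nat.cast_sub (Nat.one_le_pow _ _ (by omega))]
      push_cast; ring
    simp only [this, Finset.sum_const, Finset.card_univ, Fintype.card_fin, nsmul_eq_mul]
    push_cast; ring
  have hc' : (2 : ℝ) ≤ c := by exact_mod_cast hc
  have h3 : (c : ℝ) ^ 2 * ((c : ℝ) ^ 2 - 1) * q l l' = 0 := by linarith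
  have h4 : (c : ℝ) ^ 2 * ((c : ℝ) ^ 2 - 1) ≠ 0 := by
    have : 0 < (c : ℝ) ^ 2 - 1 := by nlinarith
    positivity
  exact (mul_eq_zero.1 h3).resolve_left h4

theorem nuC_nonneg (c : ℕ) (M : Fin (c ^ 2) × Fin 4 → Bool) : 0 ≤ nuC c M := by
  rw [nuC_eq_sum]
  exact Finset.sum_nonneg fun ε _ => mul_nonneg (rowWeight_nonneg c ε)
    (Finset.prod_nonneg fun l _ => by split_ifs <;> norm_num)

theorem sum_nuC {c : ℕ} (hc : 1 ≤ c) : ∑ M, nuC c M = 1 := by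
  have h := sum_nuC_mul_prod c fun _ _ => 1
  simp only [Finset.prod_const_one, mul_one, sumRow_one, Finset.prod_const, Finset.card_univ,
    Fintype.card_fin, ← Finset.sum_mul, sum_rowWeight hc] at h
  rw [h, ← mul_pow]
  norm_num

theorem sum_nuC_mul_sgn (c : ℕ) (e : Fin (c ^ 2) × Fin 4) :
    ∑ M, nuC c M * sgn (M e) = 0 := by
  classical
  obtain ⟨l₀, i₀⟩ := e
  have h := sum_nuC_mul_prod c fun l x => if l = l₀ then sgn (x i₀) else 1
  simp only [Finset.prod_ite_eq', Finset.mem_univ, if_true] at h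
  rw [h]
  have hrow : ∀ (ε : Fin (c ^ 2) → Bool) (l : Fin (c ^ 2)),
      sumRow (ε l) (fun x => if l = l₀ then sgn (x i₀) else 1) =
        4 * (if l = l₀ then sgn (ε l) / 2 else 1) := by
    intro ε l
    split_ifs
    · rw [sumRow_sgn]; ring
    · rw [sumRow_one]; ring
  simp only [hrow, Finset.prod_mul_distrib, Finset.prod_ite_eq', Finset.mem_univ, if_true,
    Finset.prod_const]
  rw [← mul_zero ((4 : ℝ) ^ (Finset.univ : Finset (Fin (c ^ 2))).card / 2),
    ← sum_rowWeight_mul_sgn c l₀, Finset.mul_sum]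
  exact Finset.sum_congr rfl fun ε _ => by ring

theorem sum_nuC_mul_sgn_mul_sgn {c : ℕ} (hc : 2 ≤ c) {e e' : Fin (c ^ 2) × Fin 4} (he : e ≠ e') :
    ∑ M, nuC c M * (sgn (M e) * sgn (M e')) = 0 := by
  classical
  obtain ⟨l₀, i₀⟩ := e
  obtain ⟨l₁, i₁⟩ := e'
  by_cases hl : l₀ = l₁
  · subst hl
    have hi : i₀ ≠ i₁ := fun h => he (by rw [h])
    have h := sum_nuC_mul_prod c fun l x => if l = l₀ then sgn (x i₀) * sgn (x i₁) else 1
    simp only [Finset.prod_ite_eq', Finset.mem_univ, if_true] at h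
    rw [h]
    refine Finset.sum_eq_zero fun ε _ => ?_
    rw [Finset.prod_eq_zero (Finset.mem_univ l₀), mul_zero]
    simp [sumRow_sgn_mul_sgn _ hi]
  · have h := sum_nuC_mul_prod c fun l x =>
      (if l = l₀ then sgn (x i₀) else 1) * (if l = l₁ then sgn (x i₁) else 1)
    simp only [Finset.prod_mul_distrib, Finset.prod_ite_eq', Finset.mem_univ, if_true] at h
    rw [h]
    have hrow : ∀ (ε : Fin (c ^ 2) → Bool) (l : Fin (c ^ 2)),
        sumRow (ε l) (fun x => (if l = l₀ then sgn (x i₀) else 1) *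
          (if l = l₁ then sgn (x i₁) else 1)) =
          4 * ((if l = l₀ then sgn (ε l) / 2 else 1) * (if l = l₁ then sgn (ε l) / 2 else 1)) := by
      intro ε l
      by_cases h0 : l = l₀
      · have h1 : l ≠ l₁ := fun h1 => hl (h0.symm.trans h1)
        simp only [if_pos h0, if_neg h1, mul_one, sumRow_sgn]; ring
      · by_cases h1 : l = l₁
        · simp only [if_neg h0, if_pos h1, one_mul, sumRow_sgn]; ring
        · simp only [if_neg h0, if_neg h1, one_mul, sumRow_one]; ring
    simp only [hrow, Finset.prod_mul_distrib, Finset.prod_ite_eq', Finset.mem_univ, if_true,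
      Finset.prod_const]
    rw [← mul_zero ((4 : ℝ) ^ (Finset.univ : Finset (Fin (c ^ 2))).card / 4),
      ← sum_rowWeight_mul_sgn_mul_sgn hc hl, Finset.mul_sum]
    exact Finset.sum_congr rfl fun ε _ => by ring

end RowWeight

section Fourier

variable {ι : Type*} [Fintype ι]

theorem sum_cubeChar_mul_cubeChar (x y : ι → Bool) :
    ∑ T : Finset ι, cubeChar T x * cubeChar T y =
      if x = y then (2 : ℝ) ^ Fintype.card ι else 0 := by
  have h1 : ∑ T : Finset ι, cubeChar T x * cubeChar T y = ∏ i, (1 + sgn (x i) * sgn (y i)) := by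
    rw [Finset.prod_one_add, Finset.powerset_univ]
    exact Finset.sum_congr rfl fun T _ => by simp only [cubeChar, Finset.prod_mul_distrib]
  rw [h1]
  split_ifs with h
  · subst h
    norm_num [sgn_mul_self]
  · obtain ⟨i, hi⟩ := Function.ne_iff.1 h
    refine Finset.prod_eq_zero (Finset.mem_univ i) ?_
    cases hx : x i <;> cases hy : y i <;> simp_all [sgn]

/-- A function on the cube with vanishing Fourier coefficients of weights one and two. -/
theorem sub_one_mem_highWeight [DecidableEq ι] {μ : (ι → Bool) → ℝ} (hsum : ∑ x, μ x = 1)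
    (h1 : ∀ i, ∑ x, μ x * sgn (x i) = 0)
    (h2 : ∀ i j, i ≠ j → ∑ x, μ x * (sgn (x i) * sgn (x j)) = 0) :
    (fun x => (2 : ℝ) ^ Fintype.card ι * μ x - 1) ∈ highWeight (Finset.univ : Finset ι) := by
  have hinv : (fun x => (2 : ℝ) ^ Fintype.card ι * μ x - 1) =
      ∑ T ∈ (Finset.univ : Finset (Finset ι)).erase ∅, (∑ y, μ y * cubeChar T y) • cubeChar T := by
    have h : ∑ T : Finset ι, (∑ y, μ y * cubeChar T y) • cubeChar T =
        fun x => (2 : ℝ) ^ Fintype.card ι * μ x := by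
      funext x
      simp only [Finset.sum_apply, Pi.smul_apply, smul_eq_mul, Finset.sum_mul]
      rw [Finset.sum_comm]
      simp only [mul_assoc, ← Finset.mul_sum, sum_cubeChar_mul_cubeChar]
      simp [mul_comm]
    rw [← Finset.sum_erase_add _ _ (Finset.mem_univ (∅ : Finset ι))] at h
    rw [eq_sub_of_add_eq h]
    funext x
    simp [cubeChar, hsum]
  rw [hinv]
  refine Submodule.sum_mem _ fun T hT => ?_
  by_cases hT3 : 3 ≤ T.card
  · exact Submodule.smul_mem _ _ (Submodule.subset_span ⟨T, Finset.subset_univ T, hT3, rfl⟩)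
  · have hT0 : T.card ≠ 0 := fun h => Finset.ne_of_mem_erase hT (Finset.card_eq_zero.1 h)
    have hcase : T.card = 1 ∨ T.card = 2 := by omega
    have : ∑ y, μ y * cubeChar T y = 0 := by
      rcases hcase with h | h
      · obtain ⟨i, rfl⟩ := Finset.card_eq_one.1 h
        simpa [cubeChar] using h1 i
      · obtain ⟨i, j, hij, rfl⟩ := Finset.card_eq_two.1 h
        simpa [cubeChar, Finset.prod_pair hij] using h2 i j hij
    rw [this, zero_smul]
    exact zero_mem _

/-- Pulling back a function of high weight along an injective choice of coordinates, some of which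
are negated. -/
theorem comp_mem_highWeight {V : Type*} [DecidableEq V] {F : (ι → Bool) → ℝ}
    (hF : F ∈ highWeight (Finset.univ : Finset ι)) (ρ : ι → V) (hρ : Function.Injective ρ)
    (b : ι → Bool) :
    (fun y : V → Bool => F fun e => (y (ρ e)).xor (b e)) ∈ highWeight (Finset.univ.image ρ) := by
  let Φ : ((ι → Bool) → ℝ) →ₗ[ℝ] ((V → Bool) → ℝ) :=
    LinearMap.funLeft ℝ ℝ fun (y : V → Bool) e => (y (ρ e)).xor (b e)
  have h : highWeight (Finset.univ : Finset ι) ≤ (highWeight (Finset.univ.image ρ)).comap Φ := by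
    refine Submodule.span_le.2 ?_
    rintro _ ⟨T, -, hT, rfl⟩
    have hΦ : Φ (cubeChar T) = (∏ e ∈ T, -sgn (b e)) • cubeChar (T.image ρ) := by
      funext y
      simp only [Φ, LinearMap.funLeft_apply, cubeChar, Pi.smul_apply, smul_eq_mul]
      rw [Finset.prod_image hρ.injOn, ← Finset.prod_mul_distrib]
      refine Finset.prod_congr rfl fun e _ => ?_
      cases y (ρ e) <;> cases b e <;> simp [sgn]
    rw [SetLike.mem_coe, Submodule.mem_comap, hΦ]
    exact Submodule.smul_mem _ _ (Submodule.subset_span ⟨_, Finset.image_subset_image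
      (Finset.subset_univ T), by rwa [Finset.card_image_of_injective _ hρ], rfl⟩)
  exact h hF

end Fourier

section Folding

variable {n : ℕ}

/-- The representative of the orbit of `i` under an involution. -/
def orbitRep (τ : Fin n → Fin n) (i : Fin n) : Fin n := min i (τ i)

/-- The assignment that is read off from `y` on representatives and takes opposite values at `i` and
`τ i`. -/
def oddExtension (τ : Fin n → Fin n) (y : Fin n → Bool) (i : Fin n) : Bool :=
  (y (orbitRep τ i)).xor (decide (τ i < i))

theorem oddExtension_apply_involution {τ : Fin n → Fin n} (hτ : Function.Involutive τ)
    (hfix : ∀ i, τ i ≠ i) (y : Fin n → Bool) (i : Fin n) :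
    oddExtension τ y (τ i) = !oddExtension τ y i := by
  have h1 : orbitRep τ (τ i) = orbitRep τ i := by simp only [orbitRep, hτ i, min_comm]
  have h2 : decide (i < τ i) = !decide (τ i < i) := by
    rcases lt_trichotomy i (τ i) with h | h | h
    · simp [h, h.le]
    · exact absurd h.symm (hfix i)
    · simp [h, h.le]
  rw [oddExtension, oddExtension, hτ i, h1, h2]
  simp

theorem sum_sgn_oddExtension {τ : Fin n → Fin n} (hτ : Function.Involutive τ)
    (hfix : ∀ i, τ i ≠ i) (y : Fin n → Bool) : ∑ i, sgn (oddExtension τ y i) = 0 := by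
  have h : ∑ i, sgn (oddExtension τ y i) = ∑ i, -sgn (oddExtension τ y i) :=
    Fintype.sum_equiv hτ.toPerm _ _ fun i => by
      simp [oddExtension_apply_involution hτ hfix, sgn_not]
  rw [Finset.sum_neg_distrib] at h
  linarith

theorem orbitRep_comp_injective {ι : Type*} {τ : Fin n → Fin n} {w : ι → Fin n}
    (hτ : Function.Involutive τ) (hw : Function.Injective w) (hτw : ∀ e e', w e ≠ τ (w e')) :
    Function.Injective fun e => orbitRep τ (w e) := by
  intro e e' h
  simp only [orbitRep] at h
  rcases min_choice (w e) (τ (w e)) with h1 | h1 <;>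
    rcases min_choice (w e') (τ (w e')) with h2 | h2 <;> rw [h1, h2] at h
  · exact hw h
  · exact absurd h (hτw e e')
  · exact absurd h.symm (hτw e' e)
  · exact hw (hτ.injective h)

/-- The folded assignment, as a linear map from polynomials to functions on the cube. -/
noncomputable def foldedEval (τ : Fin n → Fin n) :
    MvPolynomial (Fin n) ℝ →ₗ[ℝ] ((Fin n → Bool) → ℝ) :=
  LinearMap.pi fun y => (MvPolynomial.aeval fun i => sgn (oddExtension τ y i)).toLinearMap

theorem foldedEval_apply (τ : Fin n → Fin n) (p : MvPolynomial (Fin n) ℝ) (y : Fin n → Bool) :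
    foldedEval τ p y = MvPolynomial.eval (fun i => sgn (oddExtension τ y i)) p := by
  simp [foldedEval]

theorem foldedEval_mem_span (τ : Fin n → Fin n) {p : MvPolynomial (Fin n) ℝ} {d : ℕ}
    (hp : p.totalDegree ≤ d) :
    foldedEval τ p ∈ Submodule.span ℝ {g | ∃ W : Finset (Fin n), W.card ≤ d ∧ g ∈ juntas W} := by
  have h : foldedEval τ p = ∑ m ∈ p.support,
      p.coeff m • fun y => ∏ i ∈ m.support, sgn (oddExtension τ y i) ^ m i := by
    funext y
    rw [foldedEval_apply, MvPolynomial.eval_eq, Finset.sum_apply]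
    rfl
  rw [h]
  refine Submodule.sum_mem _ fun m hm => Submodule.smul_mem _ _ (Submodule.subset_span ?_)
  refine ⟨m.support.image (orbitRep τ), ?_, fun x y hxy => ?_⟩
  · refine Finset.card_image_le.trans (le_trans ?_ ((MvPolynomial.le_totalDegree hm).trans hp))
    rw [Finset.card_eq_sum_ones]
    exact Finset.sum_le_sum fun i hi => Nat.one_le_iff_ne_zero.2 (Finsupp.mem_support_iff.1 hi)
  · refine Finset.prod_congr rfl fun i hi => ?_
    rw [oddExtension, oddExtension, hxy _ (Finset.mem_image_of_mem _ hi)]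

theorem eval_indPM {ι : Type} [Fintype ι] (w : ι → Fin n) (a : ι → Bool) (x : Fin n → Bool) :
    MvPolynomial.eval (fun i => sgn (x i)) (indPM w a) =
      if ∀ e, x (w e) = a e then 1 else 0 := by
  classical
  have h : ∀ e, (1 / 2 : ℝ) * (1 + sgn (a e) * sgn (x (w e))) =
      if x (w e) = a e then 1 else 0 := fun e => by
    cases a e <;> cases x (w e) <;> norm_num [sgn]
  simp only [indPM, map_prod, map_mul, map_add, map_one, MvPolynomial.eval_C,
    MvPolynomial.eval_X, h]
  rw [Finset.prod_ite_zero]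
  simp

theorem card_filter_apply_eq {V ι : Type*} [Fintype V] [DecidableEq V] [Fintype ι] {ρ : ι → V}
    (hρ : Function.Injective ρ) (z : ι → Bool) :
    (Finset.univ.filter fun y : V → Bool => ∀ e, y (ρ e) = z e).card * 2 ^ Fintype.card ι =
      2 ^ Fintype.card V := by
  classical
  have h : (Finset.univ.filter fun y : V → Bool => ∀ e, y (ρ e) = z e) =
      Fintype.piFinset fun v => if v ∈ Finset.univ.image ρ
        then {Function.extend ρ z (fun _ => true) v} else Finset.univ := by
    ext y
    simp only [Finset.mem_filter, Finset.mem_univ, true_and, Fintype.mem_piFinset]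
    refine ⟨fun hy v => ?_, fun hy e => ?_⟩
    · split_ifs with hv
      · obtain ⟨e, -, rfl⟩ := Finset.mem_image.1 hv
        rw [hρ.extend_apply, hy e, Finset.mem_singleton]
      · exact Finset.mem_univ _
    · have := hy (ρ e)
      rwa [if_pos (Finset.mem_image_of_mem _ (Finset.mem_univ e)), hρ.extend_apply,
        Finset.mem_singleton] at this
  have h2 : ∀ v, (if v ∈ Finset.univ.image ρ then {Function.extend ρ z (fun _ => true) v}
      else (Finset.univ : Finset Bool)).card = if v ∈ Finset.univ.image ρ then 1 else 2 :=
    fun v => by split_ifs <;> simp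
  have hle := Finset.card_le_univ (Finset.univ.image ρ)
  rw [h, Fintype.card_piFinset, Finset.prod_congr rfl fun v _ => h2 v, Finset.prod_ite,
    Finset.prod_const_one, one_mul, Finset.prod_const, ← pow_add]
  congr 1
  rw [Finset.filter_not, Finset.filter_mem_eq_inter, Finset.univ_inter,
    Finset.card_sdiff_of_subset (Finset.subset_univ _), Finset.card_univ]
  rw [Finset.card_image_of_injective _ hρ, Finset.card_univ] at hle ⊢
  omega

variable {ι J : Type} [Fintype ι] [Fintype J] [DecidableEq J]

/-- A pseudoexpectation with prescribed pairwise uniform marginals on the scopes `w j`, supported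
on assignments that take opposite values on each orbit of the involution `τ`, exists when the
folded scopes expand. -/
theorem exists_PEpm_of_expansion {τ : Fin n → Fin n} (hτ : Function.Involutive τ)
    (hfix : ∀ i, τ i ≠ i) {w : J → ι → Fin n} (hw : ∀ j, Function.Injective (w j))
    (hτw : ∀ j e e', w j e ≠ τ (w j e')) {μ : (ι → Bool) → ℝ} (hμ0 : ∀ a, 0 ≤ μ a)
    (hμ : (fun a => (2 : ℝ) ^ Fintype.card ι * μ a - 1) ∈ highWeight (Finset.univ : Finset ι))
    {S : J → Finset (Fin n)} (hS : ∀ j, S j = Finset.univ.image fun e => orbitRep τ (w j e))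
    {D s s₀ : ℕ} (hs : 3 * s₀ + 2 ≤ s)
    (hpos : ∀ C : Finset J, C.Nonempty → C.card ≤ s →
      2 * Fintype.card ι * C.card < 2 * (C.biUnion S).card + 3 * C.card)
    (hsmall : ∀ C : Finset J, 3 ≤ C.card → C.card ≤ s →
      2 * Fintype.card ι * C.card + 2 < 2 * (C.biUnion S).card + 3 * C.card)
    (hexp : ∀ C : Finset J, C.card ≤ s →
      2 * ((C.biUnion S).card : ℤ) - (2 * (Fintype.card ι : ℤ) - 3) * C.card ≤ 2 * (D / 2 : ℕ) →
        C.card ≤ s₀) :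
    ∃ E : PEpm n D, E.satEq (∑ i, MvPolynomial.X i) 0 ∧
      ∀ j a, E.pE (indPM (w j) a) = μ a := by
  have hρ : ∀ j, Function.Injective fun e => orbitRep τ (w j e) := fun j =>
    orbitRep_comp_injective hτ (hw j) (hτw j)
  have hScard : ∀ j, (S j).card = Fintype.card ι := fun j => by
    rw [hS, Finset.card_image_of_injective _ (hρ j), Finset.card_univ]
  set f : J → (Fin n → Bool) → ℝ := fun j y =>
    (2 : ℝ) ^ Fintype.card ι * μ (fun e => oddExtension τ y (w j e)) - 1 with hf
  have hfmem : ∀ j, f j ∈ highWeight (S j) := fun j => by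
    rw [hS]
    exact comp_mem_highWeight hμ _ (hρ j) fun e => decide (τ (w j e) < w j e)
  have hf1 : ∀ j y, 1 + f j y = (2 : ℝ) ^ Fintype.card ι *
      μ (fun e => oddExtension τ y (w j e)) := fun j y => by simp only [hf]; ring
  have hf0 : ∀ j y, 0 ≤ 1 + f j y := fun j y => by
    rw [hf1]; exact mul_nonneg (by positivity) (hμ0 _)
  have hcardV : (Fintype.card (Fin n → Bool) : ℝ) = 2 ^ Fintype.card (Fin n) := by simp
  set r := 2 * s₀ + 1 with hr
  have hzero : foldedEval τ (∑ i, MvPolynomial.X i) = 0 := by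
    funext y
    rw [foldedEval_apply]
    simp [sum_sgn_oddExtension hτ hfix]
  refine ⟨⟨(pseudoMean f r).comp (foldedEval τ), ?_, ?_, ?_⟩, ⟨?_, ?_⟩, ?_⟩
  · have h1 : foldedEval τ 1 = 1 := by
      funext y; simp [foldedEval_apply]
    rw [LinearMap.comp_apply, h1, pseudoMean_eq hfmem (W := ∅) (C₀ := ∅) (by simp) (by simp)
      (noEvenCover_empty hScard (by omega) hpos) (one_mem _)]
    simp
  · intro p q hpq
    rw [LinearMap.comp_apply, LinearMap.comp_apply]
    congr 1
    funext y
    rw [foldedEval_apply, foldedEval_apply, hpq]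
  · intro p hp
    have h2 : foldedEval τ (p ^ 2) = foldedEval τ p * foldedEval τ p := by
      funext y
      simp only [foldedEval_apply, Pi.mul_apply, map_mul, sq]
    rw [LinearMap.comp_apply, h2]
    exact pseudoMean_mul_self_nonneg hScard hfmem hf0 (s₀ := s₀) (d := D / 2) (by omega)
      (fun C hC => hexp C (by omega)) (foldedEval_mem_span τ (by omega))
  · rw [LinearMap.comp_apply, hzero, map_zero]
  · have h2 : foldedEval τ ((∑ i, MvPolynomial.X i) ^ 2) = 0 := by
      funext y
      have := congrFun hzero y
      rw [foldedEval_apply] at this ⊢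
      rw [map_pow, this]
      simp
    rw [LinearMap.comp_apply, h2, map_zero]
    norm_num
  · intro j a
    have hind : foldedEval τ (indPM (w j) a) = fun y =>
        if ∀ e, oddExtension τ y (w j e) = a e then 1 else 0 := by
      funext y
      rw [foldedEval_apply, eval_indPM]
    have hmem : foldedEval τ (indPM (w j) a) ∈ juntas (S j) := by
      rw [hind]
      intro x y hxy
      have : ∀ e, oddExtension τ x (w j e) = oddExtension τ y (w j e) := fun e => by
        rw [oddExtension, oddExtension, hxy]
        rw [hS]
        exact Finset.mem_image_of_mem _ (Finset.mem_univ e)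
      simp only [this]
    change pseudoMean f r (foldedEval τ (indPM (w j) a)) = μ a
    rw [pseudoMean_eq hfmem (W := S j) (C₀ := {j}) (by simp) (by simp [hr])
      (noEvenCover_singleton hScard (by omega) hpos hsmall j) hmem, hind]
    have hterm : ∀ y : Fin n → Bool, (if ∀ e, oddExtension τ y (w j e) = a e then (1 : ℝ) else 0) *
        (∏ i ∈ {j}, (1 + f i)) y = (if ∀ e, y (orbitRep τ (w j e)) =
          (a e).xor (decide (τ (w j e) < w j e)) then 1 else 0) *
            ((2 : ℝ) ^ Fintype.card ι * μ a) := by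
      intro y
      have hiff : (∀ e, oddExtension τ y (w j e) = a e) ↔ ∀ e, y (orbitRep τ (w j e)) =
          (a e).xor (decide (τ (w j e) < w j e)) := by
        refine forall_congr' fun e => ?_
        rw [oddExtension]
        cases y (orbitRep τ (w j e)) <;> cases a e <;> cases decide (τ (w j e) < w j e) <;> simp
      by_cases h : ∀ e, oddExtension τ y (w j e) = a e
      · rw [if_pos h, if_pos (hiff.1 h), Finset.prod_singleton, Pi.add_apply, Pi.one_apply, hf1,
          funext h]
      · rw [if_neg h, if_neg (mt hiff.2 h), zero_mul, zero_mul]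
    rw [Finset.sum_congr rfl fun y _ => hterm y, ← Finset.sum_mul, Finset.sum_boole, hcardV]
    have hcount := card_filter_apply_eq (hρ j) fun e => (a e).xor (decide (τ (w j e) < w j e))
    have hcount' : ((Finset.univ.filter fun y : Fin n → Bool => ∀ e, y (orbitRep τ (w j e)) =
        (a e).xor (decide (τ (w j e) < w j e))).card : ℝ) * 2 ^ Fintype.card ι =
          2 ^ Fintype.card (Fin n) := by exact_mod_cast hcount
    rw [← mul_assoc, hcount', mul_div_assoc, mul_comm, div_mul_cancel₀ _ (by positivity)]

end Folding

section Matching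

/-- The points of `Fin n` can be partitioned into blocks of at most six points, each of which has
two disjoint perfect matchings. -/
theorem exists_blocks {n : ℕ} (hn : 6 ≤ n) (hn2 : 2 ∣ n) :
    ∃ τ₀ τ₁ b : Fin n → Fin n, Function.Involutive τ₀ ∧ Function.Involutive τ₁ ∧
      (∀ i, τ₀ i ≠ i) ∧ (∀ i, τ₁ i ≠ i) ∧ (∀ i, τ₀ i ≠ τ₁ i) ∧ (∀ i, b (τ₀ i) = b i) ∧
      (∀ i, b (τ₁ i) = b i) ∧ ∀ i, (b i : ℕ) ≤ i ∧ (i : ℕ) ≤ b i + 5 := by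
  obtain ⟨o, ho⟩ : ∃ o, o = if n % 4 = 2 then 6 else 0 := ⟨_, rfl⟩
  have ho' : o ≤ n ∧ (n - o) % 4 = 0 ∧ (o = 0 ∨ o = 6) := by split_ifs at ho <;> omega
  clear ho
  obtain ⟨ho1, ho2, ho3⟩ := ho'
  refine ⟨fun i => ⟨if (i : ℕ) % 2 = 0 then i + 1 else i - 1, ?_⟩,
    fun i => ⟨if (i : ℕ) < o then (if (i : ℕ) < 3 then i + 3 else i - 3)
      else (if ((i : ℕ) - o) % 4 < 2 then i + 2 else i - 2), ?_⟩,
    fun i => ⟨if (i : ℕ) < o then 0 else i - (i - o) % 4, ?_⟩, ?_, ?_, ?_, ?_, ?_, ?_, ?_, ?_⟩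
  · have := i.isLt; split_ifs <;> omega
  · have := i.isLt; split_ifs <;> omega
  · have := i.isLt; split_ifs <;> omega
  · intro i; ext; dsimp only; split_ifs <;> omega
  · intro i; ext; dsimp only; rcases ho3 with rfl | rfl <;> split_ifs <;> omega
  · intro i h; have := congrArg Fin.val h; dsimp only at this; split_ifs at this <;> omega
  · intro i h; have := congrArg Fin.val h; dsimp only at this; split_ifs at this <;> omega
  · intro i h; have := congrArg Fin.val h; dsimp only at this
    rcases ho3 with rfl | rfl <;> split_ifs at this <;> omega
  · intro i; ext; dsimp only; rcases ho3 with rfl | rfl <;> split_ifs <;> omega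
  · intro i; ext; dsimp only; rcases ho3 with rfl | rfl <;> split_ifs <;> omega
  · intro i; dsimp only; split_ifs <;> omega

theorem card_image_add_two_le {ι β : Type*} [Fintype ι] [DecidableEq ι] [DecidableEq β]
    {g : ι → β} {x y z : ι} (hxy : x ≠ y) (hxz : x ≠ z) (hyz : y ≠ z) (hgx : g y = g x)
    (hgz : g z = g x) : (Finset.univ.image g).card + 2 ≤ Fintype.card ι := by
  have hsub : Finset.univ.image g ⊆ (Finset.univ \ {y, z}).image g := by
    intro v hv
    obtain ⟨u, -, rfl⟩ := Finset.mem_image.1 hv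
    by_cases hu : u = y ∨ u = z
    · refine Finset.mem_image.2 ⟨x, by simp [hxy, hxz], ?_⟩
      rcases hu with rfl | rfl <;> simp [*]
    · exact Finset.mem_image_of_mem _ (by simpa using hu)
  have h1 := (Finset.card_le_card hsub).trans Finset.card_image_le
  rw [Finset.card_sdiff_of_subset (Finset.subset_univ _), Finset.card_pair hyz,
    Finset.card_univ] at h1
  have h2 : ({x, y, z} : Finset ι).card ≤ Fintype.card ι := Finset.card_le_univ _
  rw [Finset.card_eq_three.2 ⟨x, y, z, hxy, hxz, hyz, rfl⟩] at h2
  omega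

theorem card_image_add_one_le {ι β : Type*} [Fintype ι] [DecidableEq β]
    {g : ι → β} {x y : ι} (hxy : x ≠ y) (hg : g x = g y) :
    (Finset.univ.image g).card + 1 ≤ Fintype.card ι := by
  refine Nat.lt_of_le_of_ne Finset.card_image_le fun h => hxy ?_
  exact Finset.card_image_iff.1 h (Finset.mem_coe.2 (Finset.mem_univ x))
    (Finset.mem_coe.2 (Finset.mem_univ y)) hg

/-- If any one or two scopes meet almost as many blocks as possible, then one of two disjoint
matchings can be chosen on each block so that no scope contains a matched pair. -/
theorem exists_matching {V β ι J : Type*} [Fintype ι] [DecidableEq β]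
    [DecidableEq J] {τ₀ τ₁ : V → V} {b : V → β} (h₀ : Function.Involutive τ₀)
    (h₁ : Function.Involutive τ₁) (hfix₀ : ∀ i, τ₀ i ≠ i) (hfix₁ : ∀ i, τ₁ i ≠ i)
    (hne : ∀ i, τ₀ i ≠ τ₁ i) (hb₀ : ∀ i, b (τ₀ i) = b i) (hb₁ : ∀ i, b (τ₁ i) = b i)
    (w : J → ι → V)
    (hexp : ∀ C : Finset J, C.Nonempty → C.card ≤ 2 → Fintype.card ι * C.card ≤
      (C.biUnion fun j => Finset.univ.image fun e => b (w j e)).card + C.card) :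
    ∃ τ : V → V, Function.Involutive τ ∧ (∀ i, τ i ≠ i) ∧ (∀ i, b (τ i) = b i) ∧
      ∀ j e e', w j e ≠ τ (w j e') := by
  classical
  let bad : β → Prop := fun v => ∃ j e e', b (w j e) = v ∧ w j e = τ₀ (w j e')
  have hbτ : ∀ i, b (if bad (b i) then τ₁ i else τ₀ i) = b i := fun i => by
    split_ifs <;> simp [hb₀, hb₁]
  refine ⟨fun i => if bad (b i) then τ₁ i else τ₀ i, fun i => ?_, fun i => ?_, hbτ,
    fun j e e' h => ?_⟩
  · dsimp only
    rw [hbτ]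
    split_ifs
    · exact h₁ i
    · exact h₀ i
  · dsimp only
    split_ifs
    · exact hfix₁ i
    · exact hfix₀ i
  · dsimp only at h
    have hbe : b (w j e) = b (w j e') := by rw [h]; exact hbτ _
    by_cases hbad : bad (b (w j e'))
    · rw [if_pos hbad] at h
      obtain ⟨j', x, x', hx, hxx'⟩ := hbad
      have hx' : b (w j' x') = b (w j e') := by rw [← hx, hxx', hb₀]
      have hee' : e ≠ e' := fun hee' => hfix₁ (w j e') (by rw [← h, hee'])
      have hxne : x ≠ x' := fun hxne => hfix₀ (w j' x') (by rw [← hxx', hxne])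
      by_cases hj : j = j'
      · subst hj
        have hcard := hexp {j} (Finset.singleton_nonempty j) (by simp)
        rw [Finset.singleton_biUnion, Finset.card_singleton, mul_one] at hcard
        have hthird : ∃ z, e ≠ z ∧ e' ≠ z ∧ b (w j z) = b (w j e') := by
          by_contra! hcon
          have hxcase : x = e ∨ x = e' := by
            by_contra! hx0
            exact hcon x hx0.1.symm hx0.2.symm hx
          have hx'case : x' = e ∨ x' = e' := by
            by_contra! hx0
            exact hcon x' hx0.1.symm hx0.2.symm hx'
          rcases hxcase with rfl | rfl <;> rcases hx'case with rfl | rfl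
          · exact hxne rfl
          · exact hne _ (hxx'.symm.trans h)
          · refine hne (w j x) ?_
            rw [← h, hxx', h₀]
          · exact hxne rfl
        obtain ⟨z, hz1, hz2, hz3⟩ := hthird
        have := card_image_add_two_le (g := fun e => b (w j e)) hee' hz1 hz2 hbe.symm
          (hz3.trans hbe.symm)
        omega
      · have hcard := hexp {j, j'} (by simp) (by rw [Finset.card_pair hj])
        rw [Finset.card_pair hj, Finset.biUnion_insert, Finset.singleton_biUnion] at hcard
        have h1 := card_image_add_one_le (g := fun e => b (w j e)) hee' hbe
        have h2 := card_image_add_one_le (g := fun e => b (w j' e)) hxne (hx.trans hx'.symm)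
        have h3 := Finset.card_union_add_card_inter (Finset.univ.image fun e => b (w j e))
          (Finset.univ.image fun e => b (w j' e))
        have h4 : 0 < ((Finset.univ.image fun e => b (w j e)) ∩
            (Finset.univ.image fun e => b (w j' e))).card := by
          refine Finset.card_pos.2 ⟨b (w j e'), Finset.mem_inter.2
            ⟨Finset.mem_image_of_mem _ (Finset.mem_univ _), ?_⟩⟩
          rw [← hx]
          exact Finset.mem_image_of_mem _ (Finset.mem_univ _)
        omega
    · rw [if_neg hbad] at h
      exact hbad ⟨j, e, e', hbe, h⟩

end Matching

section BlockExpansion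

/-- Small sets of constraints lose at most one block per constraint, and sets of up to `s`
constraints lose at most `3 / 2 - ζ` blocks per constraint. -/
def BlockExpanding {V β κ J : Type*} [Fintype κ] [DecidableEq β] (b : V → β) (w : J → κ → V)
    (c₀ s : ℕ) (ζ : ℝ) : Prop :=
  (∀ C : Finset J, C.card ≤ c₀ → Fintype.card κ * C.card ≤
    (C.biUnion fun j => Finset.univ.image fun e => b (w j e)).card + C.card) ∧
  ∀ C : Finset J, c₀ < C.card → C.card ≤ s → (Fintype.card κ : ℝ) * C.card ≤
    (C.biUnion fun j => Finset.univ.image fun e => b (w j e)).card + (3 / 2 - ζ) * C.card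

theorem BlockExpanding.comp_equiv {V β κ κ' J : Type*} [Fintype κ] [Fintype κ'] [DecidableEq β]
    {b : V → β} {w : J → κ → V} {c₀ s : ℕ} {ζ : ℝ} (h : BlockExpanding b w c₀ s ζ) (φ : κ' ≃ κ) :
    BlockExpanding b (fun j e => w j (φ e)) c₀ s ζ := by
  have himg : ∀ j, (Finset.univ.image fun e => b (w j (φ e))) =
      Finset.univ.image fun e => b (w j e) := fun j => by
    ext v
    simp only [Finset.mem_image, Finset.mem_univ, true_and]
    exact (φ.surjective.exists (p := fun e => b (w j e) = v)).symm
  simpa only [BlockExpanding, himg, Fintype.card_congr φ] using h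

variable {n : ℕ} {ι J : Type} [Fintype ι] [Fintype J] [DecidableEq J]

theorem exists_PEpm_of_blockExpanding {τ₀ τ₁ b : Fin n → Fin n} (h₀ : Function.Involutive τ₀)
    (h₁ : Function.Involutive τ₁) (hfix₀ : ∀ i, τ₀ i ≠ i) (hfix₁ : ∀ i, τ₁ i ≠ i)
    (hne : ∀ i, τ₀ i ≠ τ₁ i) (hb₀ : ∀ i, b (τ₀ i) = b i) (hb₁ : ∀ i, b (τ₁ i) = b i)
    {w : J → ι → Fin n} (hw : ∀ j, Function.Injective (w j)) {μ : (ι → Bool) → ℝ}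
    (hμ0 : ∀ a, 0 ≤ μ a)
    (hμ : (fun a => (2 : ℝ) ^ Fintype.card ι * μ a - 1) ∈ highWeight (Finset.univ : Finset ι))
    {D s s₀ c₀ : ℕ} {ζ : ℝ} (hs : 3 * s₀ + 2 ≤ s) (hζ0 : 0 < ζ) (hζ : ζ ≤ 1 / 2) (hc₀ : 2 ≤ c₀)
    (hcζ : 1 ≤ ζ * c₀) (hs₀ : ((D / 2 : ℕ) : ℝ) < ζ * (s₀ + 1))
    (hexp : BlockExpanding b w c₀ s ζ) :
    ∃ E : PEpm n D, E.satEq (∑ i, MvPolynomial.X i) 0 ∧ ∀ j a, E.pE (indPM (w j) a) = μ a := by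
  obtain ⟨τ, hτ, hfix, hbτ, hτw⟩ := exists_matching h₀ h₁ hfix₀ hfix₁ hne hb₀ hb₁ w
    fun C _ hC => hexp.1 C (hC.trans hc₀)
  set S : J → Finset (Fin n) := fun j => Finset.univ.image fun e => orbitRep τ (w j e) with hS
  have hrep : ∀ i, b (orbitRep τ i) = b i := fun i => by
    rcases min_choice i (τ i) with h | h <;> simp [orbitRep, h, hbτ]
  have hle : ∀ C : Finset J, (C.biUnion fun j => Finset.univ.image fun e => b (w j e)).card ≤
      (C.biUnion S).card := by
    intro C
    refine le_trans (Finset.card_le_card ?_) (Finset.card_image_le (f := b))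
    intro v hv
    simp only [Finset.mem_biUnion, Finset.mem_image, Finset.mem_univ, true_and, hS] at hv ⊢
    obtain ⟨j, hj, e, rfl⟩ := hv
    exact ⟨_, ⟨j, hj, e, rfl⟩, hrep _⟩
  have hsmall : ∀ C : Finset J, C.card ≤ c₀ →
      Fintype.card ι * C.card ≤ (C.biUnion S).card + C.card := fun C hC =>
    (hexp.1 C hC).trans (Nat.add_le_add_right (hle C) _)
  have hlarge : ∀ C : Finset J, c₀ < C.card → C.card ≤ s →
      (Fintype.card ι : ℝ) * C.card ≤ (C.biUnion S).card + (3 / 2 - ζ) * C.card := by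
    intro C hC hCs
    have h := hexp.2 C hC hCs
    have h' : ((C.biUnion fun j => Finset.univ.image fun e => b (w j e)).card : ℝ) ≤
      (C.biUnion S).card := by exact_mod_cast hle C
    linarith
  refine exists_PEpm_of_expansion hτ hfix hw hτw hμ0 hμ (S := S) (fun j => rfl) (s₀ := s₀) hs
    ?_ ?_ ?_
  · intro C hC hCs
    have hpos := hC.card_pos
    rcases le_or_gt C.card c₀ with h | h
    · have := hsmall C h
      nlinarith
    · have h1 := hlarge C h hCs
      have h2 : (0 : ℝ) < C.card := by exact_mod_cast hpos
      have h3 := mul_pos hζ0 h2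
      have : (2 * Fintype.card ι * C.card : ℝ) < 2 * (C.biUnion S).card + 3 * C.card := by
        linarith
      exact_mod_cast this
  · intro C hC hCs
    rcases le_or_gt C.card c₀ with h | h
    · have := hsmall C h
      nlinarith
    · have h1 := hlarge C h hCs
      have h2 : (c₀ : ℝ) < C.card := by exact_mod_cast h
      have h3 := mul_lt_mul_of_pos_left h2 hζ0
      have : (2 * Fintype.card ι * C.card + 2 : ℝ) < 2 * (C.biUnion S).card + 3 * C.card := by
        linarith
      exact_mod_cast this
  · intro C hCs hC
    have hC' : 2 * ((C.biUnion S).card : ℝ) - (2 * (Fintype.card ι : ℝ) - 3) * C.card ≤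
        2 * ((D / 2 : ℕ) : ℝ) := by
      have := (Int.cast_le (R := ℝ)).2 hC
      simpa only [Int.cast_sub, Int.cast_mul, Int.cast_natCast, Int.cast_ofNat] using this
    have h0 : (0 : ℝ) ≤ C.card := by positivity
    have hkey : ζ * C.card ≤ ((D / 2 : ℕ) : ℝ) := by
      rcases le_or_gt C.card c₀ with h | h
      · have h1 : (Fintype.card ι : ℝ) * C.card ≤ (C.biUnion S).card + C.card := by
          exact_mod_cast hsmall C h
        nlinarith
      · have h1 := hlarge C h hCs
        linarith
    have h4 := lt_of_mul_lt_mul_left (hkey.trans_lt hs₀) hζ0.le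
    have h5 : C.card < s₀ + 1 := by exact_mod_cast h4
    omega

end BlockExpansion

section Counting

theorem descFactorial_mul_pow_le {u n : ℕ} (h : u ≤ n) (k : ℕ) :
    u.descFactorial k * n ^ k ≤ u ^ k * n.descFactorial k := by
  induction k with
  | zero => simp
  | succ k ih =>
    have h1 : (u - k) * n ≤ u * (n - k) := by
      rw [Nat.sub_mul, Nat.mul_sub]
      have := Nat.mul_le_mul_left k h
      rw [mul_comm u k]
      omega
    calc u.descFactorial (k + 1) * n ^ (k + 1)
        = ((u - k) * n) * (u.descFactorial k * n ^ k) := by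
          rw [Nat.descFactorial_succ]; ring
      _ ≤ (u * (n - k)) * (u ^ k * n.descFactorial k) := Nat.mul_le_mul h1 ih
      _ = u ^ (k + 1) * n.descFactorial (k + 1) := by rw [Nat.descFactorial_succ]; ring

variable {V κ J : Type*} [Fintype V] [DecidableEq V] [Fintype κ] [Fintype J] [DecidableEq J]

theorem card_embedding_into_le (U : Finset V) :
    ((Finset.univ.filter fun f : κ ↪ V => ∀ e, f e ∈ U).card : ℝ) ≤
      ((U.card : ℝ) / Fintype.card V) ^ Fintype.card κ * Fintype.card (κ ↪ V) := by
  have h1 : (Finset.univ.filter fun f : κ ↪ V => ∀ e, f e ∈ U).card ≤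
      U.card.descFactorial (Fintype.card κ) := by
    rw [← Fintype.card_coe U, ← Fintype.card_embedding_eq, ← Finset.card_univ]
    refine Finset.card_le_card_of_surjOn (fun g : κ ↪ U => g.trans (Function.Embedding.subtype _)) ?_
    intro f hf
    have hf' : ∀ e, f e ∈ U := by simpa using hf
    exact ⟨f.codRestrict (U : Set V) hf', by simp, by ext; rfl⟩
  rcases Nat.eq_zero_or_pos (Fintype.card V) with h0 | hpos
  · have hV : IsEmpty V := Fintype.card_eq_zero_iff.1 h0
    have hU : U = ∅ := Finset.eq_empty_of_isEmpty U
    rcases isEmpty_or_nonempty κ with hκ | ⟨⟨e⟩⟩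
    · simp
    · have : IsEmpty (κ ↪ V) := ⟨fun f => hV.false (f e)⟩
      simp
  · have h2 := descFactorial_mul_pow_le (Finset.card_le_univ U) (Fintype.card κ)
    have h3 : ((U.card.descFactorial (Fintype.card κ) : ℕ) : ℝ) * (Fintype.card V : ℝ) ^
        Fintype.card κ ≤ (U.card : ℝ) ^ Fintype.card κ *
          ((Fintype.card V).descFactorial (Fintype.card κ) : ℕ) := by exact_mod_cast h2
    have hpos' : (0 : ℝ) < (Fintype.card V : ℝ) ^ Fintype.card κ := by positivity
    rw [Fintype.card_embedding_eq, div_pow, div_mul_eq_mul_div, le_div_iff₀ hpos']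
    refine le_trans ?_ h3
    gcongr

theorem card_filter_forall_mem_le {α : Type*} [Fintype α] (C : Finset J)
    (P : α → Prop) [DecidablePred P] {q : ℝ}
    (hq : ((Finset.univ.filter P).card : ℝ) ≤ q * Fintype.card α) :
    ((Finset.univ.filter fun ω : J → α => ∀ j ∈ C, P (ω j)).card : ℝ) ≤
      q ^ C.card * Fintype.card (J → α) := by
  have h : (Finset.univ.filter fun ω : J → α => ∀ j ∈ C, P (ω j)) =
      Fintype.piFinset fun j => if j ∈ C then Finset.univ.filter P else Finset.univ := by
    ext ω
    simp only [Finset.mem_filter, Finset.mem_univ, true_and, Fintype.mem_piFinset]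
    refine forall_congr' fun j => ?_
    by_cases hj : j ∈ C <;> simp [hj]
  have h2 : q ^ C.card = ∏ j, if j ∈ C then q else 1 := by
    rw [Finset.prod_ite_mem, Finset.univ_inter, Finset.prod_const]
  have h3 : (Fintype.card (J → α) : ℝ) = ∏ _j : J, (Fintype.card α : ℝ) := by
    simp
  rw [h, Fintype.card_piFinset, Nat.cast_prod, h2, h3, ← Finset.prod_mul_distrib]
  refine Finset.prod_le_prod (fun _ _ => Nat.cast_nonneg _) fun j _ => ?_
  split_ifs
  · exact hq
  · simp

variable {β : Type*} [Fintype β] [DecidableEq β]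

/-- The number of systems of scopes in which some `c` scopes together meet at most `v` blocks. -/
theorem card_nonexpanding_le {b : V → β} {t : ℕ}
    (hb : ∀ v, (Finset.univ.filter fun i => b i = v).card ≤ t) {c v : ℕ}
    (hv : v ≤ Fintype.card β) :
    ((Finset.univ.filter fun ω : J → (κ ↪ V) => ∃ C : Finset J, C.card = c ∧
      (C.biUnion fun j => Finset.univ.image fun e => b (ω j e)).card ≤ v).card : ℝ) ≤
      (Fintype.card J).choose c * (Fintype.card β).choose v *
        (((t * v : ℝ) / Fintype.card V) ^ (Fintype.card κ * c)) *
          Fintype.card (J → (κ ↪ V)) := by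
  let F : Finset J → Finset β → Finset (J → (κ ↪ V)) := fun C A =>
    Finset.univ.filter fun ω => ∀ j ∈ C, ∀ e, ω j e ∈ Finset.univ.filter fun i => b i ∈ A
  have hsub : (Finset.univ.filter fun ω : J → (κ ↪ V) => ∃ C : Finset J, C.card = c ∧
      (C.biUnion fun j => Finset.univ.image fun e => b (ω j e)).card ≤ v) ⊆
      (Finset.powersetCard c Finset.univ).biUnion fun C =>
        (Finset.powersetCard v Finset.univ).biUnion fun A => F C A := by
    intro ω hω
    obtain ⟨-, C, hC, hCv⟩ := Finset.mem_filter.1 hω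
    obtain ⟨A, hA, -, hAv⟩ := Finset.exists_subsuperset_card_eq
      (Finset.subset_univ (C.biUnion fun j => Finset.univ.image fun e => b (ω j e))) hCv
      (by rwa [Finset.card_univ])
    refine Finset.mem_biUnion.2 ⟨C, by simp [Finset.mem_powersetCard, hC], Finset.mem_biUnion.2
      ⟨A, by simp [Finset.mem_powersetCard, hAv], ?_⟩⟩
    simp only [F, Finset.mem_filter, Finset.mem_univ, true_and]
    exact fun j hj e => hA (Finset.mem_biUnion.2 ⟨j, hj, Finset.mem_image_of_mem _
      (Finset.mem_univ e)⟩)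
  have hF : ∀ C ∈ Finset.powersetCard c (Finset.univ : Finset J),
      ∀ A ∈ Finset.powersetCard v (Finset.univ : Finset β), ((F C A).card : ℝ) ≤
        (((t * v : ℝ) / Fintype.card V) ^ (Fintype.card κ * c)) *
          Fintype.card (J → (κ ↪ V)) := by
    intro C hC A hA
    rw [Finset.mem_powersetCard] at hC hA
    have hU : (Finset.univ.filter fun i => b i ∈ A).card ≤ t * v := by
      have := Finset.card_le_mul_card_image_of_maps_to (f := b)
        (s := Finset.univ.filter fun i => b i ∈ A) (t := A) (fun i hi => (Finset.mem_filter.1 hi).2)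
        t (fun a _ => (Finset.card_le_card (Finset.filter_subset_filter _
          (Finset.subset_univ _))).trans (hb a))
      rwa [hA.2] at this
    have hU' : ((Finset.univ.filter fun i => b i ∈ A).card : ℝ) ≤ t * v := by exact_mod_cast hU
    have hq : ((Finset.univ.filter fun f : κ ↪ V => ∀ e, f e ∈ Finset.univ.filter fun i =>
        b i ∈ A).card : ℝ) ≤ ((t * v : ℝ) / Fintype.card V) ^ Fintype.card κ *
          Fintype.card (κ ↪ V) := by
      refine (card_embedding_into_le _).trans ?_
      gcongr
    have := card_filter_forall_mem_le C _ hq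
    rwa [hC.2, ← pow_mul] at this
  have hcard : (((Finset.powersetCard c (Finset.univ : Finset J)).biUnion fun C =>
        (Finset.powersetCard v Finset.univ).biUnion fun A => F C A).card : ℝ) ≤
      ∑ C ∈ Finset.powersetCard c (Finset.univ : Finset J),
        ∑ A ∈ Finset.powersetCard v (Finset.univ : Finset β), ((F C A).card : ℝ) := by
    have := Finset.card_biUnion_le (s := Finset.powersetCard c (Finset.univ : Finset J))
      (t := fun C => (Finset.powersetCard v Finset.univ).biUnion fun A => F C A)
    have h2 := this.trans (Finset.sum_le_sum fun C _ => Finset.card_biUnion_le)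
    exact_mod_cast h2
  calc _ ≤ _ := by exact_mod_cast Finset.card_le_card hsub
    _ ≤ _ := hcard
    _ ≤ ∑ C ∈ Finset.powersetCard c (Finset.univ : Finset J),
        ∑ A ∈ Finset.powersetCard v (Finset.univ : Finset β),
          (((t * v : ℝ) / Fintype.card V) ^ (Fintype.card κ * c)) *
            Fintype.card (J → (κ ↪ V)) :=
      Finset.sum_le_sum fun C hC => Finset.sum_le_sum fun A hA => hF C hC A hA
    _ = _ := by
      simp only [Finset.sum_const, Finset.card_powersetCard, Finset.card_univ, nsmul_eq_mul]
      ring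

end Counting

section UnionBound

theorem choose_mul_pow_le (N v : ℕ) :
    (N.choose v : ℝ) * (v : ℝ) ^ v ≤ (Real.exp 1 * N) ^ v := by
  have h1 : (N.choose v : ℝ) ≤ (N : ℝ) ^ v / v.factorial := Nat.choose_le_pow_div v N
  have h2 := Real.pow_div_factorial_le_exp (v : ℝ) (Nat.cast_nonneg v) v
  calc (N.choose v : ℝ) * (v : ℝ) ^ v ≤ (N : ℝ) ^ v / v.factorial * (v : ℝ) ^ v := by gcongr
    _ = (N : ℝ) ^ v * ((v : ℝ) ^ v / v.factorial) := by ring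
    _ ≤ (N : ℝ) ^ v * Real.exp v := by gcongr
    _ = (Real.exp 1 * N) ^ v := by rw [mul_pow, ← Real.exp_nat_mul, mul_one]; ring

/-- The constant in the union bound for scopes of size `k`. -/
noncomputable def unionConst (k : ℕ) : ℝ := Real.exp 1 * k * (6 * Real.exp 1) ^ k

theorem union_bound_term {k c g v n m : ℕ} {Δ : ℝ} (hm : (m : ℝ) ≤ Δ * n) (hn : 0 < n)
    (hc : 0 < c) (hcg : c ≤ g) (hv : v + g = k * c) :
    (m.choose c : ℝ) * n.choose v * ((6 * v : ℝ) / n) ^ (k * c) ≤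
      (unionConst k * Δ) ^ c * ((k * c : ℝ) / n) ^ (g - c) := by
  have hn' : (0 : ℝ) < n := by exact_mod_cast hn
  have hc' : (0 : ℝ) < c := by exact_mod_cast hc
  have he : 1 ≤ Real.exp 1 := Real.one_le_exp zero_le_one
  have h1 : (m.choose c : ℝ) ≤ (Real.exp 1 * Δ * n / c) ^ c := by
    rw [div_pow, le_div_iff₀ (by positivity)]
    refine (choose_mul_pow_le m c).trans ?_
    rw [mul_assoc]
    gcongr
  have hΔ : 0 ≤ Δ := by
    have : (0 : ℝ) ≤ Δ * n := (Nat.cast_nonneg m).trans hm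
    exact nonneg_of_mul_nonneg_left this hn'
  have h2 : (n.choose v : ℝ) * ((v : ℝ) / n) ^ v ≤ Real.exp 1 ^ (k * c) := by
    rw [div_pow, ← mul_div_assoc, div_le_iff₀ (by positivity)]
    refine (choose_mul_pow_le n v).trans ?_
    rw [mul_pow]
    gcongr
    omega
  have h3 : ((v : ℝ) / n) ^ g ≤ ((k * c : ℝ) / n) ^ g := by
    gcongr
    have : v ≤ k * c := by omega
    exact_mod_cast this
  have hsplit : ((6 * v : ℝ) / n) ^ (k * c) = 6 ^ (k * c) * ((v : ℝ) / n) ^ v * ((v : ℝ) / n) ^ g := by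
    rw [mul_div_assoc, mul_pow, mul_assoc, ← pow_add, hv]
  calc (m.choose c : ℝ) * n.choose v * ((6 * v : ℝ) / n) ^ (k * c)
      = (m.choose c : ℝ) * (6 ^ (k * c) * (n.choose v * ((v : ℝ) / n) ^ v)) *
          ((v : ℝ) / n) ^ g := by rw [hsplit]; ring
    _ ≤ (Real.exp 1 * Δ * n / c) ^ c * (6 ^ (k * c) * Real.exp 1 ^ (k * c)) *
          ((k * c : ℝ) / n) ^ g := by gcongr
    _ = (Real.exp 1 * Δ * n / c) ^ c * ((k * c : ℝ) / n) ^ c * ((6 * Real.exp 1) ^ k) ^ c *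
          ((k * c : ℝ) / n) ^ (g - c) := by
        rw [← mul_pow 6, pow_mul]
        have : ((k * c : ℝ) / n) ^ g = ((k * c : ℝ) / n) ^ c * ((k * c : ℝ) / n) ^ (g - c) := by
          rw [← pow_add, Nat.add_sub_cancel' hcg]
        rw [this]; ring
    _ = (unionConst k * Δ) ^ c * ((k * c : ℝ) / n) ^ (g - c) := by
        rw [← mul_pow, ← mul_pow]
        congr 2
        unfold unionConst
        field_simp

/-- The density of the sets of constraints whose expansion is controlled. -/
noncomputable def densityConst (k : ℕ) : ℝ := (1 / (2 * unionConst k * Real.exp 1)) ^ 4 / k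

theorem one_le_unionConst {k : ℕ} (hk : 1 ≤ k) : 1 ≤ unionConst k := by
  have he : 1 ≤ Real.exp 1 := Real.one_le_exp zero_le_one
  have hk' : (1 : ℝ) ≤ k := by exact_mod_cast hk
  have h1 : 1 ≤ Real.exp 1 * k := one_le_mul_of_one_le_of_one_le he hk'
  exact one_le_mul_of_one_le_of_one_le h1 (one_le_pow₀ (by linarith))

theorem densityConst_pos {k : ℕ} (hk : 1 ≤ k) : 0 < densityConst k := by
  have := one_le_unionConst hk
  have he := Real.exp_pos 1
  unfold densityConst
  positivity

theorem mul_densityConst_le {k : ℕ} (hk : 1 ≤ k) : k * densityConst k ≤ 1 := by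
  have hK := one_le_unionConst hk
  have he : 1 ≤ Real.exp 1 := Real.one_le_exp zero_le_one
  have hk' : (k : ℝ) ≠ 0 := by positivity
  unfold densityConst
  rw [mul_div_cancel₀ _ hk']
  refine pow_le_one₀ (by positivity) ?_
  rw [div_le_one (by positivity)]
  nlinarith

/-- The savings exponent `ζ` for which `Δ ^ (2 * ζ)` is bounded. -/
noncomputable def savings (Δ : ℝ) : ℝ := 1 / 8 / Real.log Δ

theorem savings_pos {Δ : ℝ} (hΔ : 2 ≤ Δ) : 0 < savings Δ :=
  div_pos (by norm_num) (Real.log_pos (by linarith))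

theorem savings_le {Δ : ℝ} (hΔ : 2 ≤ Δ) : savings Δ ≤ 1 / 4 := by
  have h1 : (1 / 2 : ℝ) ≤ Real.log Δ := by
    have := Real.log_two_gt_d9
    have h2 := Real.log_le_log (by norm_num) hΔ
    linarith
  unfold savings
  rw [div_le_iff₀ (by linarith)]
  linarith

theorem union_base_le {k : ℕ} (hk : 1 ≤ k) {Δ : ℝ} (hΔ : 2 ≤ Δ) :
    unionConst k * Δ * (k * (densityConst k / Δ ^ 2)) ^ (1 / 2 - savings Δ) ≤ 1 / 2 := by
  have hK := one_le_unionConst hk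
  have he : 1 ≤ Real.exp 1 := Real.one_le_exp zero_le_one
  have hζ0 := savings_pos hΔ
  have hζ := savings_le hΔ
  have hk' : (0 : ℝ) < k := by exact_mod_cast hk
  have hΔ0 : 0 < Δ := by linarith
  set x := 1 / (2 * unionConst k * Real.exp 1) with hx
  have hx0 : 0 < x := by positivity
  have hx1 : x ≤ 1 := by
    rw [hx, div_le_one (by positivity)]
    nlinarith
  have h1 : (k : ℝ) * (densityConst k / Δ ^ 2) = x ^ 4 / Δ ^ 2 := by
    unfold densityConst
    rw [← hx]
    field_simp
  have h2 : (x ^ 4) ^ (1 / 2 - savings Δ) ≤ x := by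
    have : (x ^ 4 : ℝ) ^ (1 / 4 : ℝ) = x := by
      rw [← Real.rpow_natCast, ← Real.rpow_mul hx0.le]; norm_num
    calc (x ^ 4) ^ (1 / 2 - savings Δ) ≤ (x ^ 4 : ℝ) ^ (1 / 4 : ℝ) :=
          Real.rpow_le_rpow_of_exponent_ge (by positivity) (pow_le_one₀ hx0.le hx1) (by linarith)
      _ = x := this
  have h3 : Δ = (Δ ^ 2) ^ (1 / 2 - savings Δ) * Δ ^ (2 * savings Δ) := by
    rw [← Real.rpow_natCast, ← Real.rpow_mul hΔ0.le, ← Real.rpow_add hΔ0]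
    norm_num
    ring_nf
    norm_num
  have h4 : Δ ^ (2 * savings Δ) ≤ Real.exp 1 := by
    rw [Real.rpow_def_of_pos hΔ0]
    refine Real.exp_le_exp.2 ?_
    unfold savings
    have : 0 < Real.log Δ := Real.log_pos (by linarith)
    field_simp
    norm_num
  rw [h1, Real.div_rpow (by positivity) (by positivity)]
  have hpos : 0 < (Δ ^ 2) ^ (1 / 2 - savings Δ) := Real.rpow_pos_of_pos (by positivity) _
  calc unionConst k * Δ * ((x ^ 4) ^ (1 / 2 - savings Δ) / (Δ ^ 2) ^ (1 / 2 - savings Δ))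
      = unionConst k * (Δ / (Δ ^ 2) ^ (1 / 2 - savings Δ)) * (x ^ 4) ^ (1 / 2 - savings Δ) := by
        ring
    _ = unionConst k * Δ ^ (2 * savings Δ) * (x ^ 4) ^ (1 / 2 - savings Δ) := by
        rw [show Δ / (Δ ^ 2) ^ (1 / 2 - savings Δ) = Δ ^ (2 * savings Δ) by
          rw [div_eq_iff hpos.ne', mul_comm]; exact h3]
    _ ≤ unionConst k * Real.exp 1 * x := by gcongr
    _ = 1 / 2 := by rw [hx]; field_simp

end UnionBound

section RandomScopes

variable {n k m : ℕ} {b : Fin n → Fin n} {Δ : ℝ}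

theorem card_nonexpanding_le_of_gap (hb : ∀ v, (Finset.univ.filter fun i => b i = v).card ≤ 6)
    (hm : (m : ℝ) ≤ Δ * n) (hn : 0 < n) {c g : ℕ} (hc : 0 < c) (hcg : c ≤ g) (hg : g ≤ k * c)
    (hkc : k * c ≤ n) :
    ((Finset.univ.filter fun ω : Fin m → (Fin k ↪ Fin n) => ∃ C : Finset (Fin m), C.card = c ∧
        (C.biUnion fun j => Finset.univ.image fun e => b (ω j e)).card ≤ k * c - g).card : ℝ) ≤
      (unionConst k * Δ) ^ c * ((k * c : ℝ) / n) ^ (g - c) *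
        Fintype.card (Fin m → (Fin k ↪ Fin n)) := by
  refine (card_nonexpanding_le hb (by simpa using (Nat.sub_le _ _).trans hkc)).trans ?_
  refine mul_le_mul_of_nonneg_right ?_ (Nat.cast_nonneg _)
  simpa using union_bound_term hm hn hc hcg (Nat.sub_add_cancel hg)

/-- The number of blocks that a set of `c` constraints must lose to violate the expansion bound
for large sets. -/
noncomputable def lossThreshold (ζ : ℝ) (c : ℕ) : ℕ := ⌊(3 / 2 - ζ) * c⌋₊ + 1

theorem union_bound_large (hk : 1 ≤ k) (hΔ : 2 ≤ Δ) (hn : 0 < n) {c : ℕ}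
    (hcn : (c : ℝ) ≤ densityConst k / Δ ^ 2 * n) :
    (unionConst k * Δ) ^ c * ((k * c : ℝ) / n) ^ (lossThreshold (savings Δ) c - c) ≤
      (1 / 2) ^ c := by
  have hn' : (0 : ℝ) < n := by exact_mod_cast hn
  have hk' : (0 : ℝ) < k := by exact_mod_cast hk
  have hK := one_le_unionConst hk
  have hd := densityConst_pos hk
  have hζ := savings_le hΔ
  set y : ℝ := k * (densityConst k / Δ ^ 2) with hy
  have hy0 : 0 < y := by positivity
  have hy1 : y ≤ 1 := by
    rw [hy, ← mul_div_assoc, div_le_one (by positivity)]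
    exact (mul_densityConst_le hk).trans (one_le_pow₀ (by linarith))
  have h1 : (k * c : ℝ) / n ≤ y := by
    rw [div_le_iff₀ hn', hy, mul_assoc]
    gcongr
  have h2 : (1 / 2 - savings Δ) * c ≤ ((lossThreshold (savings Δ) c - c : ℕ) : ℝ) := by
    have h3 := (Nat.lt_floor_add_one ((3 / 2 - savings Δ) * (c : ℝ))).le
    have h4 : (lossThreshold (savings Δ) c : ℝ) ≤
        ((lossThreshold (savings Δ) c - c : ℕ) : ℝ) + c := by
      exact_mod_cast le_tsub_add
    unfold lossThreshold at h4 ⊢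
    push_cast at h4 ⊢
    linarith
  calc (unionConst k * Δ) ^ c * ((k * c : ℝ) / n) ^ (lossThreshold (savings Δ) c - c)
      ≤ (unionConst k * Δ) ^ c * y ^ (lossThreshold (savings Δ) c - c) := by gcongr
    _ ≤ (unionConst k * Δ) ^ c * (y ^ (1 / 2 - savings Δ)) ^ c := by
        gcongr
        rw [← Real.rpow_natCast, ← Real.rpow_natCast, ← Real.rpow_mul hy0.le]
        exact Real.rpow_le_rpow_of_exponent_ge hy0 hy1 h2
    _ = (unionConst k * Δ * y ^ (1 / 2 - savings Δ)) ^ c := (mul_pow _ _ _).symm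
    _ ≤ (1 / 2) ^ c := by
        have := union_base_le hk hΔ
        gcongr

open Classical in
theorem card_not_blockExpanding_le (hb : ∀ v, (Finset.univ.filter fun i => b i = v).card ≤ 6)
    (hk : 2 ≤ k) (hΔ : 2 ≤ Δ) (hm : (m : ℝ) ≤ Δ * n) (hn : 0 < n) {c₀ s : ℕ} (hc₀ : k * c₀ ≤ n)
    (hs : (s : ℝ) ≤ densityConst k / Δ ^ 2 * n) :
    ((Finset.univ.filter fun ω : Fin m → (Fin k ↪ Fin n) =>
        ¬ BlockExpanding b (fun j e => ω j e) c₀ s (savings Δ)).card : ℝ) ≤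
      (∑ c ∈ Finset.Icc 1 c₀, (unionConst k * Δ) ^ c * ((k * c : ℝ) / n) +
        ∑ c ∈ Finset.Ioc c₀ s, (1 / 2 : ℝ) ^ c) * Fintype.card (Fin m → (Fin k ↪ Fin n)) := by
  set bad : ℕ → ℕ → Finset (Fin m → (Fin k ↪ Fin n)) := fun c g =>
    Finset.univ.filter fun ω => ∃ C : Finset (Fin m), C.card = c ∧
      (C.biUnion fun j => Finset.univ.image fun e => b (ω j e)).card ≤ k * c - g with hbad
  have hζ0 := savings_pos hΔ
  have hζ := savings_le hΔ
  have hn' : (0 : ℝ) < n := by exact_mod_cast hn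
  have hk1 : 1 ≤ k := by omega
  have hsub : (Finset.univ.filter fun ω : Fin m → (Fin k ↪ Fin n) =>
      ¬ BlockExpanding b (fun j e => ω j e) c₀ s (savings Δ)) ⊆
      ((Finset.Icc 1 c₀).biUnion fun c => bad c (c + 1)) ∪
        (Finset.Ioc c₀ s).biUnion fun c => bad c (lossThreshold (savings Δ) c) := by
    intro ω hω
    simp only [Finset.mem_filter, Finset.mem_univ, true_and, BlockExpanding, not_and_or,
      not_forall, not_le, Fintype.card_fin] at hω
    simp only [hbad, Finset.mem_union, Finset.mem_biUnion, Finset.mem_filter, Finset.mem_univ,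
      true_and, Finset.mem_Icc, Finset.mem_Ioc]
    rcases hω with ⟨C, hC, hlt⟩ | ⟨C, hC, hCs, hlt⟩
    · refine Or.inl ⟨C.card, ⟨?_, hC⟩, C, rfl, by omega⟩
      by_contra h
      have : C.card = 0 := by omega
      simp [this] at hlt
    · refine Or.inr ⟨C.card, ⟨hC, hCs⟩, C, rfl, ?_⟩
      set u := (C.biUnion fun j => Finset.univ.image fun e => b (ω j e)).card
      have hpos : (0 : ℝ) ≤ (3 / 2 - savings Δ) * C.card :=
        mul_nonneg (by linarith) (Nat.cast_nonneg _)
      have hu : u < k * C.card := by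
        have : (u : ℝ) < k * C.card := by linarith
        exact_mod_cast this
      have : ⌊(3 / 2 - savings Δ) * (C.card : ℝ)⌋₊ < k * C.card - u := by
        rw [Nat.floor_lt hpos, Nat.cast_sub hu.le]
        push_cast
        linarith
      unfold lossThreshold
      omega
  have hsmall : ∀ c ∈ Finset.Icc 1 c₀, ((bad c (c + 1)).card : ℝ) ≤
      (unionConst k * Δ) ^ c * ((k * c : ℝ) / n) * Fintype.card (Fin m → (Fin k ↪ Fin n)) := by
    intro c hc
    rw [Finset.mem_Icc] at hc
    have h := card_nonexpanding_le_of_gap (k := k) hb hm hn (c := c) (g := c + 1) (by omega)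
      (by omega) (by nlinarith) ((Nat.mul_le_mul_left k hc.2).trans hc₀)
    simpa using h
  have hlarge : ∀ c ∈ Finset.Ioc c₀ s, ((bad c (lossThreshold (savings Δ) c)).card : ℝ) ≤
      (1 / 2) ^ c * Fintype.card (Fin m → (Fin k ↪ Fin n)) := by
    intro c hc
    rw [Finset.mem_Ioc] at hc
    have hcn : (c : ℝ) ≤ densityConst k / Δ ^ 2 * n :=
      (by exact_mod_cast hc.2 : (c : ℝ) ≤ s).trans hs
    have hc1 : (0 : ℝ) < c := by exact_mod_cast (by omega : 0 < c)
    have hkc : k * c ≤ n := by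
      have h1 : densityConst k / Δ ^ 2 ≤ densityConst k :=
        div_le_self (densityConst_pos hk1).le (one_le_pow₀ (by linarith))
      have h2 : (k * c : ℝ) ≤ n := by
        calc (k * c : ℝ) ≤ k * (densityConst k * n) := by
              gcongr
              exact hcn.trans (by gcongr)
          _ = k * densityConst k * n := by ring
          _ ≤ 1 * n := by gcongr; exact mul_densityConst_le hk1
          _ = n := one_mul _
      exact_mod_cast h2
    refine (card_nonexpanding_le_of_gap hb hm hn (by omega) ?_ ?_ hkc).trans ?_
    · refine le_trans ?_ (Nat.le_succ _)
      refine Nat.le_floor ?_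
      nlinarith
    · have h1 : ⌊(3 / 2 - savings Δ) * (c : ℝ)⌋₊ < 2 * c := by
        rw [Nat.floor_lt (mul_nonneg (by linarith) hc1.le)]
        push_cast
        nlinarith
      have h2 := Nat.mul_le_mul_right c hk
      unfold lossThreshold
      omega
    · gcongr
      exact union_bound_large hk1 hΔ hn hcn
  calc _ ≤ ((((Finset.Icc 1 c₀).biUnion fun c => bad c (c + 1)) ∪
        (Finset.Ioc c₀ s).biUnion fun c => bad c (lossThreshold (savings Δ) c)).card : ℝ) := by
        exact_mod_cast Finset.card_le_card hsub
    _ ≤ ∑ c ∈ Finset.Icc 1 c₀, ((bad c (c + 1)).card : ℝ) +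
        ∑ c ∈ Finset.Ioc c₀ s, ((bad c (lossThreshold (savings Δ) c)).card : ℝ) := by
        exact_mod_cast (Finset.card_union_le _ _).trans
          (add_le_add Finset.card_biUnion_le Finset.card_biUnion_le)
    _ ≤ _ := by
        rw [add_mul, Finset.sum_mul, Finset.sum_mul]
        exact add_le_add (Finset.sum_le_sum hsmall) (Finset.sum_le_sum hlarge)

theorem sum_Ioc_half_pow_le (a s : ℕ) : ∑ c ∈ Finset.Ioc a s, (1 / 2 : ℝ) ^ c ≤ (1 / 2) ^ a := by
  rcases le_total s a with h | h
  · rw [Finset.Ioc_eq_empty_of_le h]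
    positivity
  · suffices ∑ c ∈ Finset.Ioc a s, (1 / 2 : ℝ) ^ c = (1 / 2) ^ a - (1 / 2) ^ s by
      rw [this]
      have : (0 : ℝ) ≤ (1 / 2) ^ s := by positivity
      linarith
    induction s, h using Nat.le_induction with
    | base => simp
    | succ s h ih =>
      rw [← Finset.insert_Ioc_right_eq_Ioc_add_one h, Finset.sum_insert (by simp), ih]
      ring

theorem uprob_ge_of_card_not_le {Ω : Type} [Fintype Ω] [Nonempty Ω] {p q : Ω → Prop}
    [DecidablePred fun ω => ¬ q ω] {δ : ℝ} (hpq : ∀ ω, q ω → p ω)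
    (h : ((Finset.univ.filter fun ω => ¬ q ω).card : ℝ) ≤ δ * Fintype.card Ω) :
    1 - δ ≤ uprob p := by
  classical
  have hpos : (0 : ℝ) < Fintype.card Ω := by exact_mod_cast Fintype.card_pos
  unfold uprob
  rw [le_div_iff₀ hpos]
  have h1 : Fintype.card Ω ≤ (Finset.univ.filter p).card +
      (Finset.univ.filter fun ω => ¬ q ω).card := by
    rw [← Finset.card_univ]
    refine le_trans (Finset.card_le_card fun ω _ => ?_) (Finset.card_union_le _ _)
    by_cases hq : q ω
    · simp [hpq ω hq]
    · simp [hq]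
  have h2 : (Fintype.card Ω : ℝ) ≤ ((Finset.univ.filter p).card : ℝ) +
      (Finset.univ.filter fun ω => ¬ q ω).card := by exact_mod_cast h1
  have h3 : ((Finset.univ.filter p).card : ℝ) =
      (@Finset.filter _ p (Classical.decPred p) Finset.univ).card := by congr
  linarith

end RandomScopes

section Main

theorem card_fiber_le_six {n : ℕ} {b : Fin n → Fin n}
    (hb : ∀ i, (b i : ℕ) ≤ i ∧ (i : ℕ) ≤ b i + 5) (v : Fin n) :
    (Finset.univ.filter fun i => b i = v).card ≤ 6 := by
  have h : ((Finset.univ.filter fun i => b i = v).map Fin.valEmbedding) ⊆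
      Finset.Icc (v : ℕ) (v + 5) := by
    intro x hx
    simp only [Finset.mem_map, Finset.mem_filter, Finset.mem_univ, true_and] at hx
    obtain ⟨i, rfl, rfl⟩ := hx
    exact Finset.mem_Icc.2 (hb i)
  have hcard := Finset.card_le_card h
  rw [Finset.card_map, Nat.card_Icc] at hcard
  omega

theorem nuC_mem_highWeight {c : ℕ} (hc : 2 ≤ c) :
    (fun a => (2 : ℝ) ^ Fintype.card (Fin (c ^ 2) × Fin 4) * nuC c a - 1) ∈
      highWeight (Finset.univ : Finset (Fin (c ^ 2) × Fin 4)) :=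
  sub_one_mem_highWeight (sum_nuC (by omega)) (sum_nuC_mul_sgn c)
    fun _ _ h => sum_nuC_mul_sgn_mul_sgn hc h

/-- The sets of constraints needed to support degree `⌊γ n / (24 Δ² log Δ)⌋` are within the range
of expansion. -/
theorem three_mul_floor_degree_le {γ : ℝ} {Δ n : ℕ} (hγ : 0 < γ)
    (hn : 6 ≤ γ / (max (Δ : ℝ) 2) ^ 2 * n) :
    3 * ⌊((⌊γ / 24 * (n : ℝ) / ((Δ : ℝ) ^ 2 * Real.log (Δ : ℝ))⌋₊ / 2 : ℕ) : ℝ) /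
      savings (max (Δ : ℝ) 2)⌋₊ + 2 ≤ ⌊γ / (max (Δ : ℝ) 2) ^ 2 * n⌋₊ := by
  set D := ⌊γ / 24 * (n : ℝ) / ((Δ : ℝ) ^ 2 * Real.log (Δ : ℝ))⌋₊ with hD
  have hle : ((D / 2 : ℕ) : ℝ) / savings (max (Δ : ℝ) 2) ≤
      γ / (max (Δ : ℝ) 2) ^ 2 * n / 6 := by
    rcases lt_or_ge Δ 2 with h | h
    · have hD0 : D = 0 := by
        rw [hD]
        interval_cases Δ <;> simp
      rw [hD0]
      simp only [Nat.zero_div, Nat.cast_zero, zero_div]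
      linarith
    · have hΔ : (2 : ℝ) ≤ Δ := by exact_mod_cast h
      have hlog : 0 < Real.log Δ := Real.log_pos (by linarith)
      rw [max_eq_left hΔ]
      have hDle : (D : ℝ) ≤ γ / 24 * (n : ℝ) / ((Δ : ℝ) ^ 2 * Real.log (Δ : ℝ)) :=
        Nat.floor_le (by positivity)
      have hhalf : ((D / 2 : ℕ) : ℝ) ≤ D / 2 := Nat.cast_div_le
      rw [div_le_iff₀ (savings_pos hΔ)]
      calc ((D / 2 : ℕ) : ℝ) ≤ γ / 24 * (n : ℝ) / ((Δ : ℝ) ^ 2 * Real.log (Δ : ℝ)) / 2 := by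
            linarith
        _ = γ / (Δ : ℝ) ^ 2 * n / 6 * savings Δ := by
            unfold savings
            field_simp
            ring
  set s₀ := ⌊((D / 2 : ℕ) : ℝ) / savings (max (Δ : ℝ) 2)⌋₊
  have hs₀ : (s₀ : ℝ) ≤ γ / (max (Δ : ℝ) 2) ^ 2 * n / 6 :=
    (Nat.floor_le (div_nonneg (Nat.cast_nonneg _) (savings_pos (le_max_right _ _)).le)).trans hle
  refine Nat.le_floor ?_
  push_cast
  linarith

end Main

/-- for the random distributional CSP whose constraints each carry ν_c on a
random scope of 4c² distinct variables, together with the exact balancedness constraint, there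
is w.h.p. a degree-Ω(n/(Δ²·log Δ)) pseudoexpectation satisfying Σᵢ xᵢ = 0 with pseudovariance
zero and whose local marginal on every constraint scope is exactly ν_c. -/
theorem stmt18 (c : ℕ) (hc : 2 ≤ c) (hceven : Even c) :
    ∃ cdeg : ℝ, 0 < cdeg ∧
      ∀ Δ : ℕ,
        ∀ δ : ℝ, 0 < δ →
          ∃ N : ℕ, ∀ n : ℕ, N ≤ n → 2 ∣ n →
            1 - δ ≤
              uprob (fun ω : Fin (Δ * n) → (Fin (c ^ 2 * 4) ↪ Fin n) =>
                ∃ E : PEpm n ⌊cdeg * (n : ℝ) / ((Δ : ℝ) ^ 2 * Real.log (Δ : ℝ))⌋₊,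
                  -- the global balancedness identity, with pseudovariance zero
                  E.satEq (∑ i, MvPolynomial.X i) 0 ∧
                  -- the local marginal on each constraint's scope is exactly ν_c
                  (∀ j : Fin (Δ * n), ∀ a : Fin (c ^ 2) × Fin 4 → Bool,
                    E.pE (indPM (fun e : Fin (c ^ 2) × Fin 4 =>
                        (ω j) (finProdFinEquiv e)) a) = nuC c a)) := by
  set k := c ^ 2 * 4 with hk
  have hk2 : 2 ≤ k := by nlinarith
  have hk1 : 1 ≤ k := by omega
  have hγ := densityConst_pos hk1
  refine ⟨densityConst k / 24, by positivity, fun Δ δ hδ => ?_⟩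
  set Δ' : ℝ := max (Δ : ℝ) 2 with hΔ'
  have h2Δ : 2 ≤ Δ' := le_max_right _ _
  have hζ0 := savings_pos h2Δ
  have hζ := savings_le h2Δ
  obtain ⟨c₁, hc₁⟩ := exists_pow_lt_of_lt_one (half_pos hδ) (by norm_num : (1 / 2 : ℝ) < 1)
  set c₀ := max (max c₁ 2) ⌈1 / savings Δ'⌉₊ with hc₀
  have hc₀2 : 2 ≤ c₀ := (le_max_right _ _).trans (le_max_left _ _)
  have hc₀ζ : 1 ≤ savings Δ' * c₀ := by
    have h1 : 1 / savings Δ' ≤ c₀ :=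
      (Nat.le_ceil _).trans (by exact_mod_cast le_max_right _ _)
    rwa [div_le_iff₀' hζ0] at h1
  have hc₀δ : (1 / 2 : ℝ) ^ c₀ ≤ δ / 2 :=
    (pow_le_pow_of_le_one (by norm_num) (by norm_num)
      ((le_max_left _ _).trans (le_max_left _ _))).trans hc₁.le
  set A : ℝ := ∑ i ∈ Finset.Icc 1 c₀, (unionConst k * Δ') ^ i * (k * i) with hA
  refine ⟨max (max 6 (k * c₀)) (max ⌈A / (δ / 2)⌉₊ ⌈6 / (densityConst k / Δ' ^ 2)⌉₊),
    fun n hn hn2 => ?_⟩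
  simp only [max_le_iff, Nat.ceil_le] at hn
  obtain ⟨⟨hn6, hnc⟩, hnA, hnγ⟩ := hn
  have hnpos : (0 : ℝ) < n := by exact_mod_cast (by omega : 0 < n)
  rw [div_le_iff₀ (by positivity)] at hnA hnγ
  obtain ⟨τ₀, τ₁, b, h₀, h₁, hfix₀, hfix₁, hne, hb₀, hb₁, hb⟩ := exists_blocks hn6 hn2
  have hne' : Nonempty (Fin k ↪ Fin n) :=
    ⟨Fin.castLEEmb ((Nat.le_mul_of_pos_right k (by omega)).trans hnc)⟩
  classical
  refine uprob_ge_of_card_not_le (q := fun ω : Fin (Δ * n) → (Fin k ↪ Fin n) =>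
    BlockExpanding b (fun j e => ω j e) c₀ ⌊densityConst k / Δ' ^ 2 * n⌋₊ (savings Δ'))
    (fun ω hω => ?_) ?_
  · refine exists_PEpm_of_blockExpanding h₀ h₁ hfix₀ hfix₁ hne hb₀ hb₁
      (fun j => (ω j).injective.comp finProdFinEquiv.injective) (nuC_nonneg c)
      (nuC_mem_highWeight hc) (three_mul_floor_degree_le hγ (by linarith)) hζ0 (by linarith)
      hc₀2 hc₀ζ ?_ (hω.comp_equiv finProdFinEquiv)
    rw [← div_lt_iff₀' hζ0]
    exact Nat.lt_floor_add_one _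
  · have hm : ((Δ * n : ℕ) : ℝ) ≤ Δ' * n := by
      push_cast
      gcongr
      exact le_max_left _ _
    have hcard := card_not_blockExpanding_le (card_fiber_le_six hb) hk2 h2Δ hm (by omega) hnc
      (Nat.floor_le (by positivity))
    convert hcard.trans (mul_le_mul_of_nonneg_right ?_ (Nat.cast_nonneg _))
    have hsmall : ∑ i ∈ Finset.Icc 1 c₀, (unionConst k * Δ') ^ i * ((k * i : ℝ) / n) ≤ δ / 2 := by
      simp only [← mul_div_assoc]
      rw [← Finset.sum_div, div_le_iff₀ hnpos]
      linarith
    have hlarge := (sum_Ioc_half_pow_le c₀ ⌊densityConst k / Δ' ^ 2 * n⌋₊).trans hc₀δ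
    linarith
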